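/- For every real A > 1 there exists a constant C_A > 0 such that for every integer q ≥ 2, every primitive Dirichlet character χ modulo q, and all real numbers X ≥ Y ≥ 2, one has |Σ_{Y ≤ p ≤ X, p prime} χ(p)| ≤ C_A * √q * X * (log X)^(-A). -/

import Mathlib

open Real

section Blocks

lemma norm_ofReal_cpow_neg_sub_le {a b : ℝ} (ha : 0 < a) (hab : a ≤ b) {s : ℂ} (hs : 0 ≤ s.re) :
    ‖(b : ℂ) ^ (-s) - (a : ℂ) ^ (-s)‖ ≤ ‖s‖ * a ^ (-s.re - 1) * (b - a) := by
  have key := (convex_Icc a b).norm_image_sub_le_of_norm_hasDerivWithin_le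
    (f := fun u : ℝ ↦ (u : ℂ) ^ (-s)) (f' := fun u : ℝ ↦ -s * (u : ℂ) ^ (-s - 1))
    (C := ‖s‖ * a ^ (-s.re - 1)) (x := a) (y := b) ?_ ?_ ⟨le_rfl, hab⟩ ⟨hab, le_rfl⟩
  · simpa [abs_of_nonneg (sub_nonneg.2 hab)] using key
  · intro u hu
    have hu0 : 0 < u := ha.trans_le hu.1
    by_cases h0 : s = 0
    · subst h0
      simpa using (hasDerivWithinAt_const u (Set.Icc a b) (1 : ℂ))
    · have h1 := (hasDerivAt_ofReal_cpow_const' hu0.ne' (r := -s - 1)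
        (by intro h; apply h0; linear_combination -h)).const_mul (-s)
      have h2 : (fun u : ℝ ↦ (u : ℂ) ^ (-s)) =
          fun y : ℝ ↦ -s * ((y : ℂ) ^ (-s - 1 + 1) / (-s - 1 + 1)) := by
        ext y
        rw [sub_add_cancel]
        field_simp
      rw [h2]
      exact h1.hasDerivWithinAt
  · intro u hu
    have hu0 : 0 < u := ha.trans_le hu.1
    rw [norm_mul, norm_neg, Complex.norm_cpow_eq_rpow_re_of_pos hu0]
    simp only [Complex.sub_re, Complex.neg_re, Complex.one_re]
    exact mul_le_mul_of_nonneg_left (Real.rpow_le_rpow_of_nonpos ha hu.1 (by linarith))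
      (norm_nonneg s)

lemma min_le_mul_rpow {A x ε : ℝ} (hA : 0 ≤ A) (hx : 0 ≤ x) (hε : 0 < ε) (hε1 : ε ≤ 1) :
    min (2 * A) (A * x) ≤ 2 * A * x ^ ε := by
  rcases le_total x 1 with h | h
  · have h1 : x ≤ x ^ ε := by
      conv_lhs => rw [← Real.rpow_one x]
      rcases hx.eq_or_lt with rfl | h0
      · rw [Real.zero_rpow hε.ne']; simp
      · exact Real.rpow_le_rpow_of_exponent_ge h0 h hε1
    calc min (2 * A) (A * x) ≤ A * x := min_le_right _ _
      _ ≤ A * x ^ ε := by gcongr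
      _ ≤ 2 * A * x ^ ε := by
        have : 0 ≤ A * x ^ ε := by positivity
        linarith
  · have h1 : 1 ≤ x ^ ε := Real.one_le_rpow h hε.le
    calc min (2 * A) (A * x) ≤ 2 * A * 1 := by simp
      _ ≤ 2 * A * x ^ ε := by gcongr

/-- The difference of `n ^ (-s)` at two nearby points, interpolated between the trivial bound
and the mean value bound. -/
lemma norm_ofReal_cpow_neg_sub_le_rpow {a b c : ℝ} (hc : 0 < c) (ha : 0 < a) (hab : a ≤ b)
    (hbc : (b - a) * c ≤ a) {s : ℂ} (hs : 0 ≤ s.re) {ε : ℝ} (hε : 0 < ε) (hε1 : ε ≤ 1) :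
    ‖(b : ℂ) ^ (-s) - (a : ℂ) ^ (-s)‖ ≤ 2 * a ^ (-s.re) * ((1 + ‖s‖) / c) ^ ε := by
  have hb : 0 < b := ha.trans_le hab
  refine le_trans (le_min ?_ ?_) (min_le_mul_rpow (by positivity) (by positivity) hε hε1)
  · refine (norm_sub_le _ _).trans ?_
    rw [Complex.norm_cpow_eq_rpow_re_of_pos hb, Complex.norm_cpow_eq_rpow_re_of_pos ha, two_mul]
    simp only [Complex.neg_re]
    gcongr 1
    exact Real.rpow_le_rpow_of_nonpos ha hab (by linarith)
  · refine (norm_ofReal_cpow_neg_sub_le ha hab hs).trans ?_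
    have h1 : b - a ≤ a / c := by rwa [le_div_iff₀ hc]
    have h2 : a ^ (-s.re - 1) * a = a ^ (-s.re) := by
      rw [Real.rpow_sub_one ha.ne']; field_simp
    calc ‖s‖ * a ^ (-s.re - 1) * (b - a) ≤ (1 + ‖s‖) * a ^ (-s.re - 1) * (a / c) := by
          gcongr
          linarith
      _ = a ^ (-s.re - 1) * a * ((1 + ‖s‖) / c) := by ring
      _ = _ := by rw [h2]

variable {q : ℕ}

/-- The contribution of the `m`-th block of length `q` to `∑ Φ(n) n ^ (-s)`, compared with the
starting point of the block. -/
noncomputable def blockTerm (Φ : ZMod q → ℂ) (s : ℂ) (m : ℕ) : ℂ :=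
  ∑ j ∈ Finset.range q, Φ j * (((m * q + j : ℕ) : ℂ) ^ (-s) - ((m * q : ℕ) : ℂ) ^ (-s))

/-- The continuation of `∑ Φ(n) n ^ (-s)` minus its polar part. -/
noncomputable def blockSum (Φ : ZMod q → ℂ) (s : ℂ) : ℂ := ∑' m, blockTerm Φ s m

/-- The majorant for `blockTerm`. -/
noncomputable def blockBound (ε : ℝ) (m : ℕ) : ℝ :=
  (if m = 0 then ∑' n : ℕ, (n : ℝ) ^ (-1 - ε / 2) else 0) + 2 * (m : ℝ) ^ (-1 - ε / 2)

lemma summable_blockBound {ε : ℝ} (hε : 0 < ε) : Summable (blockBound ε) := by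
  refine Summable.add ?_ (Summable.mul_left _ (Real.summable_nat_rpow.2 (by linarith)))
  exact summable_of_ne_finset_zero (s := {0}) (by intro b hb; simp at hb; simp [hb])

lemma norm_blockTerm_le {ε : ℝ} (hε : 0 < ε) (hε1 : ε ≤ 1) {Φ : ZMod q → ℂ}
    (hq : 0 < q) (hΦ : ∀ j, ‖Φ j‖ ≤ 1) {s : ℂ} (hs : 1 - ε / 2 ≤ s.re) (m : ℕ) :
    ‖blockTerm Φ s m‖ ≤ (q * (1 + ‖s‖)) ^ ε * blockBound ε m := by
  have hs0 : 0 < s.re := by linarith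
  have hq1 : (1 : ℝ) ≤ q := by exact_mod_cast hq
  have hsne : -s ≠ 0 := by
    intro h
    rw [neg_eq_zero] at h
    simp [h] at hs0
  have hsn : 0 ≤ ‖s‖ := norm_nonneg s
  have hone : 1 ≤ (1 + ‖s‖) ^ ε := Real.one_le_rpow (by linarith) hε.le
  rcases Nat.eq_zero_or_pos m with rfl | hm
  · have h1 : ‖blockTerm Φ s 0‖ ≤ ∑ j ∈ Finset.range q, (q : ℝ) ^ ε * (j : ℝ) ^ (-1 - ε / 2) := by
      refine norm_sum_le_of_le _ fun j hj ↦ ?_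
      rw [norm_mul]
      simp only [zero_mul, zero_add, Nat.cast_zero, Complex.zero_cpow hsne, sub_zero]
      rcases Nat.eq_zero_or_pos j with rfl | hj0
      · simp only [Nat.cast_zero, Complex.zero_cpow hsne, norm_zero, mul_zero]
        positivity
      · have hj1 : (1 : ℝ) ≤ j := by exact_mod_cast hj0
        have hjq : (j : ℝ) ≤ q := by exact_mod_cast (Finset.mem_range.1 hj).le
        rw [Complex.norm_natCast_cpow_of_pos hj0]
        calc ‖Φ j‖ * (j : ℝ) ^ (-s).re ≤ 1 * (j : ℝ) ^ (-1 + ε / 2) := by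
              gcongr
              · exact hΦ _
              · simp; linarith
          _ = (j : ℝ) ^ ε * (j : ℝ) ^ (-1 - ε / 2) := by
              rw [← Real.rpow_add (by linarith), one_mul]; congr 1; ring
          _ ≤ _ := by gcongr
    refine h1.trans ?_
    rw [← Finset.mul_sum, Real.mul_rpow (by positivity) (by positivity)]
    have h2 : ∑ j ∈ Finset.range q, (j : ℝ) ^ (-1 - ε / 2) ≤ ∑' n : ℕ, (n : ℝ) ^ (-1 - ε / 2) :=
      (Real.summable_nat_rpow.2 (by linarith)).sum_le_tsum _ (fun _ _ ↦ by positivity)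
    have h3 : blockBound ε 0 = ∑' n : ℕ, (n : ℝ) ^ (-1 - ε / 2) := by
      simp [blockBound, Real.zero_rpow (show -1 - ε / 2 ≠ 0 by linarith)]
    rw [h3]
    have h4 : 0 ≤ ∑' n : ℕ, (n : ℝ) ^ (-1 - ε / 2) := tsum_nonneg fun _ ↦ by positivity
    calc _ ≤ (q : ℝ) ^ ε * 1 * ∑' n : ℕ, (n : ℝ) ^ (-1 - ε / 2) := by
          rw [mul_one]; gcongr
      _ ≤ _ := by gcongr
  · have hm1 : (1 : ℝ) ≤ m := by exact_mod_cast hm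
    have h1 : ‖blockTerm Φ s m‖ ≤ ∑ j ∈ Finset.range q,
        2 * ((m : ℝ) * q) ^ (-1 + ε / 2) * ((1 + ‖s‖) / m) ^ ε := by
      refine norm_sum_le_of_le _ fun j hj ↦ ?_
      have hjq : (j : ℝ) ≤ q := by exact_mod_cast (Finset.mem_range.1 hj).le
      rw [norm_mul]
      have := norm_ofReal_cpow_neg_sub_le_rpow (a := (m : ℝ) * q) (b := (m : ℝ) * q + j)
        (c := m) (by linarith) (by positivity) (by simp)
        (by rw [add_sub_cancel_left, mul_comm]; gcongr) hs0.le hε hε1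
      push_cast at this ⊢
      calc _ ≤ 1 * (2 * ((m : ℝ) * q) ^ (-s.re) * ((1 + ‖s‖) / m) ^ ε) := by
            gcongr
            exact hΦ _
        _ ≤ _ := by
            rw [one_mul]
            gcongr
            · nlinarith
            · linarith
    refine h1.trans ?_
    have h3 : blockBound ε m = 2 * (m : ℝ) ^ (-1 - ε / 2) := by
      simp [blockBound, hm.ne']
    have hm0 : (0 : ℝ) < m := by linarith
    have hq0 : (0 : ℝ) < q := by linarith
    have e1 : (q : ℝ) * (q : ℝ) ^ (-1 + ε / 2) = (q : ℝ) ^ (ε / 2) := by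
      rw [← Real.rpow_one_add' hq0.le (by linarith)]; congr 1; ring
    have e2 : (m : ℝ) ^ (-1 + ε / 2) / (m : ℝ) ^ ε = (m : ℝ) ^ (-1 - ε / 2) := by
      rw [← Real.rpow_sub hm0]; congr 1; ring
    rw [h3, Finset.sum_const, Finset.card_range, nsmul_eq_mul,
      Real.mul_rpow hm0.le hq0.le, Real.div_rpow (by positivity) hm0.le,
      Real.mul_rpow (by positivity) (by positivity), ← e2]
    have e3 : (q : ℝ) ^ (ε / 2) ≤ (q : ℝ) ^ ε := Real.rpow_le_rpow_of_exponent_le hq1 (by linarith)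
    calc _ = (q * (q : ℝ) ^ (-1 + ε / 2)) * (1 + ‖s‖) ^ ε *
          (2 * ((m : ℝ) ^ (-1 + ε / 2) / (m : ℝ) ^ ε)) := by ring
      _ ≤ _ := by rw [e1]; gcongr

lemma norm_blockSum_le {ε : ℝ} (hε : 0 < ε) (hε1 : ε ≤ 1) :
    ∃ C : ℝ, 0 < C ∧ ∀ (q : ℕ), 0 < q → ∀ Φ : ZMod q → ℂ, (∀ j, ‖Φ j‖ ≤ 1) → ∀ s : ℂ,
      1 - ε / 2 ≤ s.re → ‖blockSum Φ s‖ ≤ C * (q * (1 + ‖s‖)) ^ ε := by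
  refine ⟨∑' m, blockBound ε m + 1, ?_, fun q hq Φ hΦ s hs ↦ ?_⟩
  · have : 0 ≤ ∑' m, blockBound ε m := tsum_nonneg fun m ↦ by
      unfold blockBound
      have : 0 ≤ ∑' n : ℕ, (n : ℝ) ^ (-1 - ε / 2) := tsum_nonneg fun _ ↦ by positivity
      split_ifs <;> positivity
    linarith
  · have h := tsum_of_norm_bounded ((summable_blockBound hε).hasSum.mul_left _)
      (norm_blockTerm_le hε hε1 hq hΦ hs)
    refine h.trans ?_
    have : 0 ≤ (q * (1 + ‖s‖)) ^ ε := by positivity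
    nlinarith

lemma differentiableOn_blockSum {Φ : ZMod q → ℂ} (hq : 0 < q) (hΦ : ∀ j, ‖Φ j‖ ≤ 1) :
    DifferentiableOn ℂ (blockSum Φ) {s | 1 / 2 < s.re} := by
  intro s hs
  have hU : IsOpen ({s : ℂ | 1 / 2 < s.re} ∩ Metric.ball 0 (‖s‖ + 1)) :=
    (isOpen_lt continuous_const Complex.continuous_re).inter Metric.isOpen_ball
  have h : DifferentiableOn ℂ (blockSum Φ)
      ({s : ℂ | 1 / 2 < s.re} ∩ Metric.ball 0 (‖s‖ + 1)) := by
    refine Complex.differentiableOn_tsum_of_summable_norm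
      (u := fun m ↦ (q * (1 + (‖s‖ + 1))) ^ (1 : ℝ) * blockBound 1 m)
      ((summable_blockBound one_pos).mul_left _) (fun m ↦ ?_) hU ?_
    · intro w hw
      have hw0 : -w ≠ 0 := by
        intro h
        rw [neg_eq_zero] at h
        have := hw.1
        simp [h] at this
        linarith
      refine DifferentiableAt.differentiableWithinAt ?_
      unfold blockTerm
      refine DifferentiableAt.fun_sum fun j _ ↦ ?_
      refine (DifferentiableAt.sub ?_ ?_).const_mul _ <;>
      exact DifferentiableAt.const_cpow (by fun_prop) (Or.inr hw0)
    · intro m w hw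
      have hw1 : 1 / 2 < w.re := hw.1
      have hw2 : ‖w‖ < ‖s‖ + 1 := by simpa using hw.2
      refine (norm_blockTerm_le one_pos le_rfl hq hΦ (by linarith) m).trans ?_
      have hb : 0 ≤ blockBound 1 m := by
        unfold blockBound
        have : 0 ≤ ∑' n : ℕ, (n : ℝ) ^ (-1 - (1 : ℝ) / 2) := tsum_nonneg fun _ ↦ by positivity
        split_ifs <;> positivity
      gcongr
  exact ((h s ⟨hs, by simp⟩).differentiableAt (hU.mem_nhds ⟨hs, by simp⟩)).differentiableWithinAt

lemma LSeries_eq_blockSum_add [NeZero q] (Φ : ZMod q → ℂ) (hΦ : ∀ j, ‖Φ j‖ ≤ 1) {s : ℂ}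
    (hs : 1 < s.re) :
    LSeries (Φ ·) s = blockSum Φ s + (∑ j, Φ j) * (q : ℂ) ^ (-s) * riemannZeta s := by
  have hq : 0 < q := Nat.pos_of_neZero q
  have hsne : -s ≠ 0 := by
    intro h
    rw [neg_eq_zero] at h
    simp [h] at hs
    linarith
  have hterm (n : ℕ) : LSeries.term (Φ ·) s n = Φ n * (n : ℂ) ^ (-s) := by
    rcases eq_or_ne n 0 with rfl | hn
    · simp [Complex.zero_cpow hsne]
    · rw [LSeries.term_of_ne_zero hn, Complex.cpow_neg, div_eq_mul_inv]
  have hsum : Summable fun n : ℕ ↦ Φ n * (n : ℂ) ^ (-s) := by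
    have := ZMod.LSeriesSummable_of_one_lt_re Φ hs
    simpa only [LSeriesSummable, funext hterm] using this
  have h1 : LSeries (Φ ·) s = ∑' n : ℕ, Φ n * (n : ℂ) ^ (-s) := by
    rw [LSeries]; exact tsum_congr hterm
  have h2 : HasSum (fun m : ℕ ↦ ∑ j ∈ Finset.range q, Φ j * ((m * q + j : ℕ) : ℂ) ^ (-s))
      (∑' n : ℕ, Φ n * (n : ℂ) ^ (-s)) := by
    have h3 := (Nat.divModEquiv q).symm.hasSum_iff.2 hsum.hasSum
    have h4 := h3.prod_fiberwise fun m ↦ hasSum_fintype _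
    convert h4 using 2 with m
    rw [Finset.sum_range]
    refine Finset.sum_congr rfl fun j _ ↦ ?_
    simp [Nat.divModEquiv]
  have h5 : HasSum (fun m : ℕ ↦ blockTerm Φ s m) (blockSum Φ s) := by
    refine Summable.hasSum ?_
    refine Summable.of_norm_bounded ((summable_blockBound one_pos).mul_left _)
      (norm_blockTerm_le one_pos le_rfl hq hΦ (by linarith))
  have h6 : HasSum (fun m : ℕ ↦ (∑ j, Φ j) * (q : ℂ) ^ (-s) * (m : ℂ) ^ (-s))
      ((∑ j, Φ j) * (q : ℂ) ^ (-s) * riemannZeta s) := by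
    refine HasSum.mul_left _ ?_
    have h7 : (fun n : ℕ ↦ (n : ℂ) ^ (-s)) = fun n ↦ LSeries.term 1 s n := by
      ext n
      rcases eq_or_ne n 0 with rfl | hn
      · simp [Complex.zero_cpow hsne]
      · rw [LSeries.term_of_ne_zero hn, Complex.cpow_neg]; simp
    rw [h7]
    exact LSeriesHasSum_one hs
  rw [h1]
  refine h2.unique ?_
  convert h5.add h6 using 2 with m
  have hΦs : ∑ j, Φ j = ∑ j ∈ Finset.range q, Φ j := by
    obtain ⟨k, rfl⟩ : ∃ k, q = k + 1 := ⟨q - 1, by omega⟩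
    rw [Finset.sum_range]
    refine Finset.sum_congr rfl fun j _ ↦ ?_
    congr 1
    exact (Fin.cast_val_eq_self j).symm
  rw [hΦs, blockTerm, Finset.sum_mul, Finset.sum_mul, ← Finset.sum_add_distrib]
  refine Finset.sum_congr rfl fun j _ ↦ ?_
  rw [Nat.cast_mul m q, Complex.natCast_mul_natCast_cpow]
  ring

lemma LFunction_eq_blockSum [NeZero q] {Φ : ZMod q → ℂ} (hΦ : ∀ j, ‖Φ j‖ ≤ 1)
    (hΦ0 : ∑ j, Φ j = 0) {s : ℂ} (hs : 1 / 2 < s.re) : ZMod.LFunction Φ s = blockSum Φ s := by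
  have hq : 0 < q := Nat.pos_of_neZero q
  have hU : IsOpen {s : ℂ | 1 / 2 < s.re} := isOpen_lt continuous_const Complex.continuous_re
  have h1 : AnalyticOnNhd ℂ (ZMod.LFunction Φ) {s : ℂ | 1 / 2 < s.re} :=
    (ZMod.differentiable_LFunction_of_sum_zero hΦ0).differentiableOn.analyticOnNhd hU
  have h2 := (differentiableOn_blockSum hq hΦ).analyticOnNhd hU
  refine h1.eqOn_of_preconnected_of_eventuallyEq h2 (convex_halfSpace_re_gt _).isPreconnected
    (z₀ := 2) (by simp; norm_num) ?_ hs
  filter_upwards [(isOpen_lt continuous_const Complex.continuous_re).mem_nhds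
    (show (2 : ℂ) ∈ {s : ℂ | 1 < s.re} by simp)] with w hw
  rw [ZMod.LFunction_eq_LSeries Φ hw, LSeries_eq_blockSum_add Φ hΦ hw, hΦ0]
  simp

end Blocks

section UpperBounds

lemma norm_natCast_cpow_sub_integral_le {n : ℕ} (hn : 0 < n) {ε : ℝ} (hε : 0 < ε) (hε1 : ε ≤ 1)
    {s : ℂ} (hs : 1 < s.re) :
    ‖(n : ℂ) ^ (-s) - ((n : ℂ) ^ (1 - s) - ((n + 1 : ℕ) : ℂ) ^ (1 - s)) / (s - 1)‖ ≤
      2 * (1 + ‖s‖) ^ ε * (n : ℝ) ^ (-1 - ε) := by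
  have hn0 : (0 : ℝ) < n := by exact_mod_cast hn
  have hn1 : (1 : ℝ) ≤ n := by exact_mod_cast hn
  have hs1 : s - 1 ≠ 0 := by
    intro h
    rw [sub_eq_zero] at h
    simp [h] at hs
  have key := (convex_Icc (n : ℝ) (n + 1)).norm_image_sub_le_of_norm_hasDerivWithin_le
    (f := fun u : ℝ ↦ (u : ℂ) * (n : ℂ) ^ (-s) + (u : ℂ) ^ (-s + 1) / (s - 1))
    (f' := fun u : ℝ ↦ (n : ℂ) ^ (-s) - (u : ℂ) ^ (-s))
    (C := 2 * (1 + ‖s‖) ^ ε * (n : ℝ) ^ (-1 - ε)) (x := (n : ℝ)) (y := n + 1) ?_ ?_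
    ⟨le_rfl, by linarith⟩ ⟨by linarith, le_rfl⟩
  · simp only [add_sub_cancel_left, norm_one, mul_one] at key
    refine le_trans (le_of_eq ?_) key
    congr 1
    push_cast
    rw [neg_add_eq_sub]
    ring
  · intro u hu
    have hu0 : 0 < u := hn0.trans_le hu.1
    have h1 := hasDerivAt_ofReal_cpow_const' hu0.ne' (r := -s)
      (by intro h; apply hs1; linear_combination -h)
    have h2 : HasDerivAt (fun u : ℝ ↦ (u : ℂ) * (n : ℂ) ^ (-s)) ((n : ℂ) ^ (-s)) u := by
      simpa using (Complex.ofRealCLM.hasDerivAt (x := u)).mul_const ((n : ℂ) ^ (-s))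
    have h3 := (h2.sub h1).hasDerivWithinAt (s := Set.Icc (n : ℝ) (n + 1))
    convert h3 using 1
    ext y
    have : -s + 1 ≠ 0 := by intro h; apply hs1; linear_combination -h
    simp only [Pi.sub_apply]
    field_simp
    ring
  · intro u hu
    have h := norm_ofReal_cpow_neg_sub_le_rpow (a := n) (b := u) (c := n) hn0 hn0 hu.1
      (by nlinarith [hu.2]) (s := s) (by linarith) hε hε1
    rw [norm_sub_rev]
    refine h.trans ?_
    rw [Real.div_rpow (by positivity) hn0.le, Real.rpow_sub hn0]
    have : (n : ℝ) ^ (-s.re) ≤ (n : ℝ) ^ (-1 : ℝ) :=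
      Real.rpow_le_rpow_of_exponent_le hn1 (by linarith)
    calc _ = 2 * (1 + ‖s‖) ^ ε * ((n : ℝ) ^ (-s.re) / (n : ℝ) ^ ε) := by ring
      _ ≤ _ := by gcongr

lemma norm_riemannZeta_le {ε : ℝ} (hε : 0 < ε) (hε1 : ε ≤ 1) :
    ∃ C : ℝ, 0 < C ∧ ∀ s : ℂ, 1 < s.re →
      ‖riemannZeta s‖ ≤ C * (1 + ‖s‖) ^ ε + 1 / ‖s - 1‖ := by
  have hsum : Summable fun n : ℕ ↦ ((n + 1 : ℕ) : ℝ) ^ (-1 - ε) :=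
    (summable_nat_add_iff 1).2 (Real.summable_nat_rpow.2 (by linarith))
  refine ⟨2 * ∑' n : ℕ, ((n + 1 : ℕ) : ℝ) ^ (-1 - ε), ?_, fun s hs ↦ ?_⟩
  · have := hsum.tsum_pos (fun _ ↦ by positivity) 0 (by simp)
    positivity
  set D : ℕ → ℂ := fun n ↦ ((n + 1 : ℕ) : ℂ) ^ (-s) -
    (((n + 1 : ℕ) : ℂ) ^ (1 - s) - ((n + 1 + 1 : ℕ) : ℂ) ^ (1 - s)) / (s - 1) with hD
  have hDle (n : ℕ) : ‖D n‖ ≤ 2 * (1 + ‖s‖) ^ ε * ((n + 1 : ℕ) : ℝ) ^ (-1 - ε) :=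
    norm_natCast_cpow_sub_integral_le n.succ_pos hε hε1 hs
  have hDsum : Summable D := Summable.of_norm_bounded (hsum.mul_left _) hDle
  have hzeta : HasSum (fun n : ℕ ↦ ((n + 1 : ℕ) : ℂ) ^ (-s)) (riemannZeta s) := by
    rw [zeta_eq_tsum_one_div_nat_add_one_cpow hs]
    have : Summable fun n : ℕ ↦ 1 / ((n : ℂ) + 1) ^ s := by
      have := (summable_nat_add_iff 1).2 (Complex.summable_one_div_nat_cpow.2 hs)
      simpa using this
    convert this.hasSum using 2 with n
    rw [Complex.cpow_neg]; simp
  have htel : HasSum (fun n : ℕ ↦ (((n + 1 : ℕ) : ℂ) ^ (1 - s) -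
      ((n + 1 + 1 : ℕ) : ℂ) ^ (1 - s)) / (s - 1)) (1 / (s - 1)) := by
    have h1 : Summable (fun n : ℕ ↦ (((n + 1 : ℕ) : ℂ) ^ (1 - s) -
      ((n + 1 + 1 : ℕ) : ℂ) ^ (1 - s)) / (s - 1)) := by
      have := hzeta.summable.sub hDsum
      simpa only [hD, sub_sub_cancel] using this
    refine (h1.hasSum_iff_tendsto_nat).2 ?_
    have h2 (N : ℕ) : ∑ n ∈ Finset.range N, (((n + 1 : ℕ) : ℂ) ^ (1 - s) -
        ((n + 1 + 1 : ℕ) : ℂ) ^ (1 - s)) / (s - 1) =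
        (1 - ((N + 1 : ℕ) : ℂ) ^ (1 - s)) / (s - 1) := by
      rw [← Finset.sum_div, Finset.sum_range_sub' (fun n : ℕ ↦ ((n + 1 : ℕ) : ℂ) ^ (1 - s))]
      simp
    simp only [h2]
    have h3 : Filter.Tendsto (fun N : ℕ ↦ ((N + 1 : ℕ) : ℂ) ^ (1 - s)) Filter.atTop (nhds 0) := by
      rw [tendsto_zero_iff_norm_tendsto_zero]
      have h4 : (fun N : ℕ ↦ ‖((N + 1 : ℕ) : ℂ) ^ (1 - s)‖) =
          fun N : ℕ ↦ ((N + 1 : ℕ) : ℝ) ^ (-(s.re - 1)) := by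
        ext N
        rw [Complex.norm_natCast_cpow_of_pos N.succ_pos]; simp
      rw [h4]
      exact ((tendsto_rpow_neg_atTop (by linarith)).comp tendsto_natCast_atTop_atTop).comp
        (Filter.tendsto_add_atTop_nat 1)
    simpa using (h3.const_sub 1).div_const (s - 1)
  have hz : riemannZeta s = ∑' n, D n + 1 / (s - 1) := by
    have := (hzeta.sub htel).unique hDsum.hasSum
    linear_combination this
  rw [hz]
  refine (norm_add_le _ _).trans (add_le_add ?_ (by simp))
  refine (tsum_of_norm_bounded (hsum.hasSum.mul_left _) hDle).trans (le_of_eq ?_)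
  ring

open DirichletCharacter

lemma norm_LFunction_le {ε : ℝ} (hε : 0 < ε) (hε1 : ε < 1) :
    ∃ C : ℝ, 0 < C ∧ ∀ (q : ℕ) [NeZero q] (χ : DirichletCharacter ℂ q), χ ≠ 1 → ∀ s : ℂ,
      1 - ε / 2 ≤ s.re → ‖LFunction χ s‖ ≤ C * (q * (1 + ‖s‖)) ^ ε := by
  obtain ⟨C, hC, h⟩ := norm_blockSum_le hε hε1.le
  refine ⟨C, hC, fun q _ χ hχ s hs ↦ ?_⟩
  rw [LFunction, LFunction_eq_blockSum χ.norm_le_one (MulChar.sum_eq_zero_of_ne_one hχ)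
    (by linarith)]
  exact h q (Nat.pos_of_neZero q) χ χ.norm_le_one s hs

lemma norm_LFunction_one_le {ε : ℝ} (hε : 0 < ε) (hε1 : ε ≤ 1) :
    ∃ C : ℝ, 0 < C ∧ ∀ (q : ℕ) [NeZero q], ∀ s : ℂ, 1 < s.re →
      ‖LFunction (1 : DirichletCharacter ℂ q) s‖ ≤ C * (q * (1 + ‖s‖)) ^ ε + 1 / ‖s - 1‖ := by
  obtain ⟨C, hC, h⟩ := norm_blockSum_le hε hε1
  obtain ⟨C', hC', h'⟩ := norm_riemannZeta_le hε hε1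
  refine ⟨C + C', by positivity, fun q _ s hs ↦ ?_⟩
  have hq : (1 : ℝ) ≤ q := by exact_mod_cast Nat.pos_of_neZero q
  have hb := norm_le_one (1 : DirichletCharacter ℂ q)
  rw [LFunction_eq_LSeries _ hs, LSeries_eq_blockSum_add _ hb hs]
  refine (norm_add_le _ _).trans ?_
  have h1 := h q (Nat.pos_of_neZero q) _ hb s (by linarith)
  have h2 : ‖(∑ j, (1 : DirichletCharacter ℂ q) j) * (q : ℂ) ^ (-s)‖ ≤ 1 := by
    rw [norm_mul, Complex.norm_natCast_cpow_of_pos (Nat.pos_of_neZero q)]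
    calc _ ≤ (q : ℝ) * (q : ℝ) ^ (-1 : ℝ) := by
          gcongr
          · refine (norm_sum_le_of_le _ fun j _ ↦ hb j).trans ?_
            simp
          · simpa using hs.le
      _ = 1 := by rw [Real.rpow_neg_one, mul_inv_cancel₀ (by linarith)]
  have h3 : (1 + ‖s‖) ^ ε ≤ (q * (1 + ‖s‖)) ^ ε := by
    gcongr
    exact le_mul_of_one_le_left (by positivity) hq
  have h4 := h' s hs
  rw [norm_mul]
  calc _ ≤ C * (q * (1 + ‖s‖)) ^ ε + 1 * (C' * (q * (1 + ‖s‖)) ^ ε + 1 / ‖s - 1‖) := by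
        gcongr
        exact h4.trans (by gcongr)
    _ = _ := by ring

lemma one_add_norm_le {s : ℂ} (h0 : 0 ≤ s.re) (h1 : s.re ≤ 3) :
    1 + ‖s‖ ≤ 2 * (2 + |s.im|) := by
  have := Complex.norm_le_abs_re_add_abs_im s
  rw [abs_of_nonneg h0] at this
  linarith [abs_nonneg s.im]

lemma norm_iteratedDeriv_LFunction_le {ε : ℝ} (hε : 0 < ε) (hε1 : ε < 1) (j : ℕ) :
    ∃ C : ℝ, 0 < C ∧ ∀ (q : ℕ) [NeZero q] (χ : DirichletCharacter ℂ q), χ ≠ 1 → ∀ s : ℂ,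
      1 ≤ s.re → s.re ≤ 2 →
        ‖iteratedDeriv j (LFunction χ) s‖ ≤ C * (q * (2 + |s.im|)) ^ ε := by
  obtain ⟨C, hC, h⟩ := norm_LFunction_le hε hε1
  refine ⟨j.factorial * (C * 3 ^ ε) / (ε / 2) ^ j, by positivity, fun q _ χ hχ s hs1 hs2 ↦ ?_⟩
  have := Complex.norm_iteratedDeriv_le_of_forall_mem_sphere_norm_le (c := s) (R := ε / 2)
    (C := C * (3 * (q * (2 + |s.im|))) ^ ε) (f := LFunction χ) j (by positivity)
    (differentiable_LFunction hχ).diffContOnCl ?_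
  · refine this.trans (le_of_eq ?_)
    rw [Real.mul_rpow (by positivity) (by positivity)]
    ring
  · intro z hz
    rw [mem_sphere_iff_norm] at hz
    have hre : |z.re - s.re| ≤ ε / 2 := by
      rw [← hz, ← Complex.sub_re]; exact Complex.abs_re_le_norm _
    rw [abs_le] at hre
    refine (h q χ hχ z (by linarith [hre.1])).trans ?_
    have h1 : ‖z‖ ≤ ‖s‖ + 1 := by
      have := norm_le_norm_add_norm_sub' z s
      linarith
    have h2 := one_add_norm_le (s := s) (by linarith) (by linarith)
    have h3 : (q : ℝ) * (1 + ‖z‖) ≤ 3 * (q * (2 + |s.im|)) := by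
      calc (q : ℝ) * (1 + ‖z‖) ≤ q * (3 * (2 + |s.im|)) := by
            gcongr; linarith [abs_nonneg s.im]
        _ = _ := by ring
    exact mul_le_mul_of_nonneg_left (Real.rpow_le_rpow (by positivity) h3 hε.le) hC.le

end UpperBounds

section Siegel

open Complex DirichletCharacter Finset Filter Topology

lemma residue_lower_bound {G : ℂ → ℂ} (hG : Differentiable ℂ G) {l : ℂ} {B : ℝ}
    (hB : ∀ z ∈ Metric.sphere (2 : ℂ) (4 / 3), ‖G z‖ ≤ B)
    (hb : ∀ m : ℕ, 0 ≤ ((-1) ^ m * iteratedDeriv m G 2 / m.factorial + l).re) {b : ℝ}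
    (hb0 : b ≤ (G 2 + l).re) {σ : ℝ} (hσ : 7 / 8 ≤ σ) (hσ1 : σ < 1)
    (hneg : (G σ + l / (σ - 1)).re ≤ 0) {N : ℕ} (hN : 1 ≤ N)
    (hBN : B * (27 / 32) ^ N * (32 / 5) ≤ b / 2) :
    b / 2 * (1 - σ) ≤ l.re * (2 - σ) ^ N := by
  set f : ℕ → ℂ := fun m ↦ (m.factorial : ℂ)⁻¹ • ((σ : ℂ) - 2) ^ m • iteratedDeriv m G 2 with hf
  have hsum : HasSum f (G σ) := hasSum_taylorSeries_of_entire hG 2 σ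
  have hf_le (m : ℕ) : ‖f m‖ ≤ B * (27 / 32) ^ m := by
    have h1 := norm_iteratedDeriv_le_of_forall_mem_sphere_norm_le m (by norm_num : (0 : ℝ) < 4 / 3)
      hG.diffContOnCl hB
    have h2 : ‖(σ : ℂ) - 2‖ ≤ 9 / 8 := by
      rw [show (σ : ℂ) - 2 = ((σ - 2 : ℝ) : ℂ) by push_cast; rfl, norm_real, Real.norm_eq_abs,
        abs_le]
      constructor <;> linarith
    have hm : (0 : ℝ) < m.factorial := by positivity
    simp only [hf, smul_eq_mul, norm_mul, norm_inv, Complex.norm_natCast, norm_pow]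
    calc _ ≤ (m.factorial : ℝ)⁻¹ * ((9 / 8) ^ m * (m.factorial * B / (4 / 3) ^ m)) := by gcongr
      _ = B * (27 / 32) ^ m := by
        have h3 : (27 / 32 : ℝ) ^ m = (9 / 8) ^ m * ((4 / 3) ^ m)⁻¹ := by
          rw [← inv_pow, ← mul_pow]; norm_num
        rw [h3, div_eq_mul_inv]
        field_simp
  have htail := norm_sub_le_of_geometric_bound_of_hasSum (by norm_num) hf_le hsum N
  have htail' := (abs_le.mp ((abs_re_le_norm _).trans htail)).2
  have hfm (m : ℕ) : (f m).re =
      ((-1) ^ m * iteratedDeriv m G 2 / m.factorial + l).re * (2 - σ) ^ m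
        - l.re * (2 - σ) ^ m := by
    have : f m = ((2 - σ) ^ m : ℝ) * ((-1) ^ m * iteratedDeriv m G 2 / m.factorial) := by
      have h3 : (σ : ℂ) - 2 = (-1) * ((2 : ℂ) - σ) := by ring
      simp only [hf, smul_eq_mul]
      rw [h3, mul_pow]
      push_cast
      ring
    rw [this, re_ofReal_mul, add_re]
    ring
  have hs : b - l.re * (((2 - σ) ^ N - 1) / (1 - σ)) ≤ (∑ m ∈ range N, f m).re := by
    rw [re_sum]
    simp only [hfm]
    rw [sum_sub_distrib, ← mul_sum, geom_sum_eq (by linarith), show 2 - σ - 1 = 1 - σ by ring]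
    refine sub_le_sub_right ?_ _
    refine le_trans ?_ (single_le_sum (f := fun m ↦
      ((-1) ^ m * iteratedDeriv m G 2 / m.factorial + l).re * (2 - σ) ^ m)
      (fun m _ ↦ mul_nonneg (hb m) (pow_nonneg (by linarith) m)) (mem_range.mpr hN))
    simpa using hb0
  have hl : (l / (σ - 1)).re = -(l.re / (1 - σ)) := by
    rw [show l / ((σ : ℂ) - 1) = ((-(1 / (1 - σ)) : ℝ) : ℂ) * l by
      rw [← neg_sub (1 : ℂ), div_neg]; push_cast; ring, re_ofReal_mul]
    ring
  rw [add_re, hl] at hneg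
  rw [sub_re] at htail'
  have h5 : B * (27 / 32) ^ N / (1 - 27 / 32) = B * (27 / 32) ^ N * (32 / 5) := by ring
  have h6 : b / 2 ≤ l.re * ((2 - σ) ^ N) / (1 - σ) := by
    have : l.re * (((2 - σ) ^ N - 1) / (1 - σ)) =
        l.re * ((2 - σ) ^ N) / (1 - σ) - l.re / (1 - σ) := by
      ring
    linarith
  rwa [le_div_iff₀ (by linarith)] at h6

lemma iteratedDeriv_inv_sub_one (m : ℕ) :
    (-1) ^ m * iteratedDeriv m (fun s : ℂ ↦ (s - 1)⁻¹) 2 / m.factorial = 1 := by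
  have := congrFun (iter_deriv_inv_linear_sub (𝕜 := ℂ) m 1 1) 2
  rw [iteratedDeriv_eq_iterate]
  simp only [one_mul] at this
  rw [this]
  have : (m.factorial : ℂ) ≠ 0 := by exact_mod_cast m.factorial_ne_zero
  norm_num
  rw [← mul_assoc, ← mul_pow]
  simp [this]

lemma norm_apply_one_ge {b : ℝ} (hb : 0 < b) :
    ∃ c : ℝ, 0 < c ∧ ∀ P : ℂ → ℂ, Differentiable ℂ P → ∀ M : ℝ, 1 ≤ M →
      (∀ z ∈ Metric.sphere (2 : ℂ) (4 / 3), ‖P z‖ ≤ M) →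
      (∀ m : ℕ, 0 ≤ ((-1) ^ m * iteratedDeriv m (fun s ↦ riemannZeta s * P s) 2).re) →
      b ≤ (riemannZeta 2 * P 2).re → ∀ σ : ℝ, 7 / 8 ≤ σ → σ < 1 →
      (riemannZeta σ * P σ).re ≤ 0 → c * (1 - σ) * M ^ (-(7 * (1 - σ))) ≤ ‖P 1‖ := by
  obtain ⟨Z, hZ⟩ := (isCompact_sphere (2 : ℂ) (4 / 3)).exists_bound_of_continuousOn
    differentiable_riemannZeta₀.continuous.continuousOn
  have hZ0 : 0 ≤ Z := (norm_nonneg _).trans (hZ (2 + (4 / 3 : ℝ)) (by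
    rw [mem_sphere_iff_norm, add_sub_cancel_left, norm_real]; norm_num))
  set A : ℝ := max 1 (64 / 5 * (Z + 6) / b) with hA
  have hA1 : 1 ≤ A := le_max_left _ _
  have hA2 : 64 / 5 * (Z + 6) ≤ A * b := by
    rw [← div_le_iff₀ hb]; exact le_max_right _ _
  refine ⟨b / 2 * (rexp 1 * A ^ (7 : ℝ))⁻¹, by positivity,
    fun P hP M hM hPM halt hb0 σ hσ hσ1 hneg ↦ ?_⟩
  set G : ℂ → ℂ := fun s ↦ riemannZeta₀ s * P s + dslope P 1 s with hGdef
  have hG : Differentiable ℂ G := by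
    refine (differentiable_riemannZeta₀.mul hP).add ?_
    rw [← differentiableOn_univ]
    exact (differentiableOn_dslope univ_mem).mpr hP.differentiableOn
  have hGs {s : ℂ} (hs : s ≠ 1) : G s = riemannZeta s * P s - P 1 * (s - 1)⁻¹ := by
    simp only [hGdef]
    rw [riemannZeta_eq_inv_sub_add hs, dslope_of_ne _ hs, slope_def_field]
    ring
  have hP1 : ‖P 1‖ ≤ M := by
    refine norm_le_of_forall_mem_frontier_norm_le Metric.isBounded_ball hP.diffContOnCl
      (U := Metric.ball (2 : ℂ) (4 / 3)) (fun z hz ↦ hPM z ?_) (subset_closure ?_)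
    · rwa [frontier_ball _ (by norm_num)] at hz
    · rw [mem_ball_iff_norm]; norm_num
  have hB : ∀ z ∈ Metric.sphere (2 : ℂ) (4 / 3), ‖G z‖ ≤ (Z + 6) * M := by
    intro z hz
    have hz1 : 1 / 3 ≤ ‖z - 1‖ := by
      have h1 : ‖z - 2‖ ≤ ‖z - 1‖ + 1 := by
        calc ‖z - 2‖ = ‖(z - 1) - 1‖ := by ring_nf
          _ ≤ _ := by simpa using norm_sub_le (z - 1) 1
      rw [mem_sphere_iff_norm] at hz
      linarith
    have hz2 : z ≠ 1 := by rintro rfl; norm_num at hz1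
    have h2 : ‖dslope P 1 z‖ ≤ 6 * M := by
      rw [dslope_of_ne _ hz2, slope_def_field, norm_div, div_le_iff₀ (by linarith)]
      have := norm_sub_le (P z) (P 1)
      have := hPM z hz
      nlinarith
    calc ‖G z‖ ≤ ‖riemannZeta₀ z‖ * ‖P z‖ + ‖dslope P 1 z‖ := by
          rw [← norm_mul]; exact norm_add_le _ _
      _ ≤ Z * M + 6 * M := by
          gcongr
          · exact hZ z hz
          · exact hPM z hz
      _ = _ := by ring
  have hder (m : ℕ) : (-1) ^ m * iteratedDeriv m G 2 / m.factorial + P 1 =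
      (((m.factorial : ℝ)⁻¹ : ℝ) : ℂ) *
        ((-1) ^ m * iteratedDeriv m (fun s ↦ riemannZeta s * P s) 2) := by
    have h1 : (fun s ↦ riemannZeta s * P s) =ᶠ[𝓝 2] (G + fun s ↦ P 1 * (s - 1)⁻¹) := by
      filter_upwards [isOpen_ne.mem_nhds (by norm_num : (2 : ℂ) ≠ 1)] with s hs
      simp [hGs hs]
    have h2 : ContDiffAt ℂ m (fun s : ℂ ↦ (s - 1)⁻¹) 2 :=
      (contDiffAt_id.sub contDiffAt_const).inv (by norm_num)
    rw [h1.iteratedDeriv_eq, iteratedDeriv_add hG.contDiff.contDiffAt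
      (contDiffAt_const.mul h2), iteratedDeriv_const_mul_field]
    have h3 := iteratedDeriv_inv_sub_one m
    push_cast
    linear_combination (-P 1) * h3
  set L := Real.log (A * M) with hL
  have hAM : 1 ≤ A * M := by nlinarith
  have hL0 : 0 ≤ L := Real.log_nonneg hAM
  set N : ℕ := ⌊7 * L⌋₊ + 1 with hN
  have hN1 : 7 * L ≤ N := by rw [hN]; push_cast; exact (Nat.lt_floor_add_one _).le
  have hN2 : (N : ℝ) ≤ 7 * L + 1 := by
    rw [hN]; push_cast; linarith [Nat.floor_le (by positivity : 0 ≤ 7 * L)]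
  have hexpL : rexp L = A * M := Real.exp_log (by positivity)
  have hpow : (27 / 32 : ℝ) ^ N ≤ (A * M)⁻¹ := by
    have h1 : (27 / 32 : ℝ) ≤ rexp (-(1 / 7)) := by
      linarith [Real.add_one_le_exp (-(1 / 7) : ℝ)]
    calc (27 / 32 : ℝ) ^ N ≤ (rexp (-(1 / 7))) ^ N := by gcongr
      _ = rexp (-(N / 7)) := by rw [← Real.exp_nat_mul]; ring_nf
      _ ≤ rexp (-L) := by gcongr; linarith
      _ = _ := by rw [Real.exp_neg, hexpL]
  have key := residue_lower_bound hG hB (l := P 1) (b := b) (fun m ↦ ?_) ?_ hσ hσ1 ?_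
    (N := N) (by omega) ?_
  · have h1 : (2 - σ) ^ N ≤ rexp 1 * A ^ (7 : ℝ) * M ^ (7 * (1 - σ)) := by
      calc (2 - σ) ^ N ≤ (rexp (1 - σ)) ^ N := by
            gcongr
            · linarith
            · linarith [Real.add_one_le_exp (1 - σ)]
        _ = rexp (N * (1 - σ)) := by rw [← Real.exp_nat_mul]
        _ ≤ rexp (1 + L * (7 * (1 - σ))) := by
            gcongr
            nlinarith
        _ = rexp 1 * (A * M) ^ (7 * (1 - σ)) := by
            rw [Real.exp_add, Real.rpow_def_of_pos (by positivity)]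
        _ ≤ _ := by
            rw [Real.mul_rpow (by positivity) (by positivity), mul_assoc]
            gcongr
            linarith
    have hre : (P 1).re ≤ ‖P 1‖ := Complex.re_le_norm _
    have h2 : b / 2 * (1 - σ) ≤ ‖P 1‖ * (rexp 1 * A ^ (7 : ℝ) * M ^ (7 * (1 - σ))) :=
      key.trans (mul_le_mul hre h1 (pow_nonneg (by linarith) _) (norm_nonneg _))
    rw [Real.rpow_neg (by positivity)]
    have h3 : 0 < rexp 1 * A ^ (7 : ℝ) * M ^ (7 * (1 - σ)) := by positivity
    rw [← div_le_iff₀ h3] at h2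
    refine le_trans (le_of_eq ?_) h2
    field_simp
  · rw [hder, re_ofReal_mul]
    exact mul_nonneg (by positivity) (halt m)
  · rw [hGs (by norm_num)]
    norm_num
    simpa using hb0
  · rw [hGs (by exact_mod_cast hσ1.ne)]
    rw [div_eq_mul_inv, sub_add_cancel]
    exact hneg
  · calc (Z + 6) * M * (27 / 32) ^ N * (32 / 5) ≤ (Z + 6) * M * (A * M)⁻¹ * (32 / 5) := by gcongr
      _ ≤ b / 2 := by
        rw [mul_inv]
        have : 0 < A := by positivity
        field_simp
        linarith

end Siegel

section RealCharacters

open Complex DirichletCharacter Finset Filter Topology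
open scoped ComplexOrder
open scoped ArithmeticFunction.vonMangoldt

/-- The coefficients of the logarithmic derivative of `L(s, χ)`, up to sign. -/
noncomputable abbrev twistedLambda {q : ℕ} (χ : DirichletCharacter ℂ q) : ℕ → ℂ :=
  (fun n : ℕ ↦ χ n) * fun n : ℕ ↦ (Λ n : ℂ)

lemma hasDerivAt_LFunction {q : ℕ} [NeZero q] (χ : DirichletCharacter ℂ q) {s : ℂ}
    (hs : 1 < s.re) :
    HasDerivAt (LFunction χ) (-LSeries (twistedLambda χ) s * LFunction χ s) s := by
  have h1 : DifferentiableAt ℂ (LFunction χ) s :=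
    differentiableAt_LFunction χ s (.inl (by rintro rfl; simp at hs))
  have h2 := LSeries_ne_zero_of_one_lt_re χ hs
  refine h1.hasDerivAt.congr_deriv ?_
  rw [LSeries_twist_vonMangoldt_eq χ hs, deriv_LFunction_eq_deriv_LSeries χ hs,
    LFunction_eq_LSeries χ hs]
  field_simp

lemma neg_one_pow_mul_iteratedDeriv_nonneg {F : ℂ → ℂ} {v : ℕ → ℂ} (hv : 0 ≤ v)
    (hvs : ∀ s : ℂ, 1 < s.re → LSeriesSummable v s)
    (hF : ∀ s : ℂ, 1 < s.re → HasDerivAt F (-LSeries v s * F s) s) (h2 : 0 ≤ F 2) (m : ℕ) :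
    0 ≤ (-1) ^ m * iteratedDeriv m F 2 := by
  have habs : LSeries.abscissaOfAbsConv v ≤ (1 : ℝ) :=
    LSeries.abscissaOfAbsConv_le_of_forall_lt_LSeriesSummable fun y hy ↦ hvs y (by simpa using hy)
  have habs2 : LSeries.abscissaOfAbsConv v < (2 : ℝ) :=
    habs.trans_lt (by exact_mod_cast one_lt_two)
  have hO : IsOpen {s : ℂ | 1 < s.re} := isOpen_lt continuous_const continuous_re
  have hm : {s : ℂ | 1 < s.re} ∈ 𝓝 (2 : ℂ) := hO.mem_nhds (by norm_num)
  have hFc (n : ℕ) : ContDiffAt ℂ n F 2 := by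
    refine DifferentiableOn.contDiffOn (s := {s : ℂ | 1 < s.re}) (fun s hs ↦ ?_) hO |>.contDiffAt hm
    exact (hF s hs).differentiableAt.differentiableWithinAt
  have hVc (n : ℕ) : ContDiffAt ℂ n (LSeries v) 2 := by
    refine DifferentiableOn.contDiffOn (s := {s : ℂ | 1 < s.re}) (fun s hs ↦ ?_) hO |>.contDiffAt hm
    refine (LSeries_hasDerivAt (habs.trans_lt ?_)).differentiableAt.differentiableWithinAt
    exact_mod_cast hs
  induction m using Nat.strong_induction_on with
  | _ m ih =>
  rcases m with _ | m
  · simpa using h2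
  have h1 : deriv F =ᶠ[𝓝 2] fun s ↦ -(LSeries v s * F s) := by
    filter_upwards [hm] with s hs
    rw [(hF s hs).deriv, neg_mul]
  rw [iteratedDeriv_succ', h1.iteratedDeriv_eq, iteratedDeriv_fun_neg,
    iteratedDeriv_fun_mul (hVc m) (hFc m)]
  have h3 : (-1 : ℂ) ^ (m + 1) * -∑ i ∈ range (m + 1), (m.choose i : ℂ) *
      iteratedDeriv i (LSeries v) 2 * iteratedDeriv (m - i) F 2 =
      ∑ i ∈ range (m + 1), (m.choose i : ℂ) * ((-1) ^ i * iteratedDeriv i (LSeries v) 2) *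
        ((-1) ^ (m - i) * iteratedDeriv (m - i) F 2) := by
    rw [pow_succ, mul_neg_one, neg_mul_neg, mul_sum]
    refine sum_congr rfl fun i hi ↦ ?_
    have : (-1 : ℂ) ^ m = (-1) ^ i * (-1) ^ (m - i) := by
      rw [← pow_add, Nat.add_sub_cancel' (by simpa [Nat.lt_succ_iff] using hi)]
    rw [this]
    ring
  rw [h3]
  refine sum_nonneg fun i hi ↦ mul_nonneg (mul_nonneg (by exact_mod_cast Nat.zero_le _) ?_) ?_
  · simpa using LSeries.iteratedDeriv_alternating hv habs2 i
  · exact ih _ (by omega)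

lemma natCast_cpow_neg_ofReal_im (n : ℕ) (σ : ℝ) : ((n : ℂ) ^ (-(σ : ℂ))).im = 0 := by
  rw [← ofReal_natCast, ← ofReal_neg, ← ofReal_cpow (Nat.cast_nonneg n), ofReal_im]

lemma quadratic_im_eq_zero {q : ℕ} {χ : DirichletCharacter ℂ q} (hχ : χ.IsQuadratic) (a : ZMod q) :
    (χ a).im = 0 := by
  rcases hχ a with h | h | h <;> simp [h]

lemma LFunction_im_eq_zero {q : ℕ} [NeZero q] {χ : DirichletCharacter ℂ q} (hχ : χ.IsQuadratic)
    (h1 : χ ≠ 1) {σ : ℝ} (hσ : 1 / 2 < σ) : (LFunction χ σ).im = 0 := by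
  rw [LFunction, LFunction_eq_blockSum χ.norm_le_one (MulChar.sum_eq_zero_of_ne_one h1)
    (by simpa using hσ)]
  have hb (m : ℕ) : (blockTerm χ σ m).im = 0 := by
    rw [blockTerm, im_sum]
    refine sum_eq_zero fun j _ ↦ ?_
    rw [mul_im, sub_im, natCast_cpow_neg_ofReal_im, natCast_cpow_neg_ofReal_im,
      quadratic_im_eq_zero hχ]
    simp
  have : blockSum χ σ = ((∑' m, (blockTerm χ σ m).re : ℝ) : ℂ) := by
    rw [blockSum, ofReal_tsum]
    refine tsum_congr fun m ↦ ?_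
    exact Complex.ext (by simp) (by simp [hb])
  rw [this, ofReal_im]

lemma one_third_le_LFunction_two {q : ℕ} [NeZero q] {χ : DirichletCharacter ℂ q}
    (hχ : χ.IsQuadratic) (h1 : χ ≠ 1) : ((1 / 3 : ℝ) : ℂ) ≤ LFunction χ 2 := by
  have him := LFunction_im_eq_zero hχ h1 (σ := 2) (by norm_num)
  rw [Complex.le_def]
  refine ⟨?_, by simpa using him.symm⟩
  have hs : LSeriesSummable (χ ·) 2 := LSeriesSummable_of_one_lt_re χ (by norm_num)
  have h0 : LSeries (χ ·) 2 = 1 + ∑' n : ℕ, LSeries.term (χ ·) 2 (n + 2) := by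
    rw [LSeries, ← hs.sum_add_tsum_nat_add 2]
    simp [sum_range_succ]
  have hz := (hasSum_nat_add_iff' 2).mpr hasSum_zeta_two
  have hle : ‖∑' n : ℕ, LSeries.term (χ ·) 2 (n + 2)‖ ≤ π ^ 2 / 6 - 1 := by
    refine tsum_of_norm_bounded (g := fun n : ℕ ↦ 1 / ((n + 2 : ℕ) : ℝ) ^ 2) ?_ fun n ↦ ?_
    · simpa [sum_range_succ] using hz
    · rw [LSeries.norm_term_eq, if_neg (by omega)]
      have := χ.norm_le_one ((n + 2 : ℕ) : ZMod q)
      rw [show ((2 : ℂ).re) = ((2 : ℕ) : ℝ) by norm_num, Real.rpow_natCast]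
      gcongr
  rw [LFunction_eq_LSeries χ (by norm_num), h0, add_re]
  have h3 := (abs_le.mp ((abs_re_le_norm _).trans hle)).1
  have hpi : π ^ 2 < 10 := by nlinarith [Real.pi_lt_d2, Real.pi_pos]
  norm_num at h3 hpi ⊢
  linarith

lemma one_le_riemannZeta_two : 1 ≤ riemannZeta 2 := by
  rw [riemannZeta_two]
  have h : (1 : ℝ) ≤ π ^ 2 / 6 := by nlinarith [Real.pi_gt_three]
  exact_mod_cast h

end RealCharacters

section SiegelBound

open Complex DirichletCharacter Finset Filter Topology
open scoped ComplexOrder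
open scoped ArithmeticFunction.vonMangoldt

lemma exists_mul_character {q₁ q₂ : ℕ} [NeZero q₁] [NeZero q₂] {χ₁ : DirichletCharacter ℂ q₁}
    {χ₂ : DirichletCharacter ℂ q₂} (hne : χ₁.conductor ≠ χ₂.conductor) :
    ∃ ψ : DirichletCharacter ℂ (q₁ * q₂), ψ ≠ 1 ∧ ∀ n : ℕ, ψ n = χ₁ n * χ₂ n := by
  set η₁ := changeLevel (q₁.dvd_mul_right q₂) χ₁ with hη₁
  set η₂ := changeLevel (q₂.dvd_mul_left q₁) χ₂ with hη₂
  refine ⟨η₁ * η₂, fun h ↦ hne ?_, fun n ↦ ?_⟩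
  · have h3 : η₁ = η₂⁻¹ := mul_eq_one_iff_eq_inv.mp h
    rw [← conductor_changeLevel χ₁ (q₁.dvd_mul_right q₂), ← hη₁, h3, conductor_inv,
      conductor_changeLevel]
  · rw [MulChar.mul_apply]
    by_cases hn : n.Coprime (q₁ * q₂)
    · have hc : IsCoprime (n : ℤ) ((q₁ * q₂ : ℕ) : ℤ) := Nat.isCoprime_iff_coprime.mpr hn
      have e₁ := changeLevel_eq_cast_of_dvd' χ₁ (q₁.dvd_mul_right q₂) hc
      have e₂ := changeLevel_eq_cast_of_dvd' χ₂ (q₂.dvd_mul_left q₁) hc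
      simp only [Int.cast_natCast] at e₁ e₂
      rw [hη₁, hη₂, e₁, e₂]
    · rw [MulChar.map_nonunit η₁ (by rwa [ZMod.isUnit_iff_coprime]), zero_mul]
      rw [Nat.coprime_mul_iff_right, not_and_or] at hn
      rcases hn with hn | hn
      · rw [MulChar.map_nonunit χ₁ (by rwa [ZMod.isUnit_iff_coprime]), zero_mul]
      · rw [MulChar.map_nonunit χ₂ (by rwa [ZMod.isUnit_iff_coprime]), mul_zero]

lemma norm_LFunction_sphere_le : ∃ C : ℝ, 1 ≤ C ∧ ∀ (q : ℕ) [NeZero q]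
    (χ : DirichletCharacter ℂ q), χ ≠ 1 → ∀ z ∈ Metric.sphere (2 : ℂ) (4 / 3),
      ‖LFunction χ z‖ ≤ C * q := by
  obtain ⟨C, hC, h⟩ := norm_LFunction_le (ε := 2 / 3) (by norm_num) (by norm_num)
  refine ⟨max 1 (C * 5), le_max_left _ _, fun q _ χ hχ z hz ↦ ?_⟩
  have hq : (1 : ℝ) ≤ q := by exact_mod_cast Nat.pos_of_neZero q
  rw [mem_sphere_iff_norm] at hz
  have h1 : |z.re - 2| ≤ 4 / 3 := by
    rw [← hz]; simpa using abs_re_le_norm (z - 2)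
  have h2 : ‖z‖ ≤ 10 / 3 := by
    have := norm_le_norm_add_norm_sub' z 2
    rw [hz] at this
    norm_num at this
    linarith
  refine (h q χ hχ z (by linarith [(abs_le.mp h1).1])).trans ?_
  have h3 : 1 ≤ (q : ℝ) * (1 + ‖z‖) := by nlinarith [norm_nonneg z]
  calc C * (q * (1 + ‖z‖)) ^ (2 / 3 : ℝ) ≤ C * (q * (1 + ‖z‖)) ^ (1 : ℝ) := by
        gcongr
        norm_num
    _ = C * (q * (1 + ‖z‖)) := by rw [Real.rpow_one]
    _ ≤ C * (q * 5) := by gcongr; linarith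
    _ = C * 5 * q := by ring
    _ ≤ _ := by gcongr; exact le_max_right _ _

lemma hasDerivAt_riemannZeta {s : ℂ} (hs : 1 < s.re) :
    HasDerivAt riemannZeta
      (-LSeries (twistedLambda (1 : DirichletCharacter ℂ 1)) s * riemannZeta s) s := by
  have := hasDerivAt_LFunction (1 : DirichletCharacter ℂ 1) hs
  rwa [LFunction_modOne_eq] at this

lemma one_add_quadratic_nonneg {q : ℕ} {χ : DirichletCharacter ℂ q} (hχ : χ.IsQuadratic)
    (a : ZMod q) : 0 ≤ 1 + χ a := by
  rcases hχ a with h | h | h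
  · simp [h]
  · rw [h]; norm_num
  · simp [h]

lemma zeta_mul_LFunction_alternating {q : ℕ} [NeZero q] {χ : DirichletCharacter ℂ q}
    (hχ : χ.IsQuadratic) (h1 : χ ≠ 1) (m : ℕ) :
    0 ≤ (-1) ^ m * iteratedDeriv m (fun s ↦ riemannZeta s * LFunction χ s) 2 := by
  have hs₀ {s : ℂ} (hs : 1 < s.re) :=
    LSeriesSummable_twist_vonMangoldt (1 : DirichletCharacter ℂ 1) hs
  have hs₁ {s : ℂ} (hs : 1 < s.re) := LSeriesSummable_twist_vonMangoldt χ hs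
  refine neg_one_pow_mul_iteratedDeriv_nonneg
    (v := twistedLambda (1 : DirichletCharacter ℂ 1) + twistedLambda χ) (fun n ↦ ?_)
    (fun s hs ↦ (hs₀ hs).add (hs₁ hs)) (fun s hs ↦ ?_) ?_ m
  · have h := mul_nonneg (one_add_quadratic_nonneg hχ (n : ZMod q))
      (zero_le_real.mpr (ArithmeticFunction.vonMangoldt_nonneg (n := n)))
    simpa [Subsingleton.elim (n : ZMod 1) 1, add_mul] using h
  · rw [LSeries_add (hs₀ hs) (hs₁ hs)]
    refine ((hasDerivAt_riemannZeta hs).mul (hasDerivAt_LFunction χ hs)).congr_deriv ?_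
    ring
  · exact mul_nonneg (zero_le_one.trans one_le_riemannZeta_two)
      ((zero_le_real.mpr (by norm_num)).trans (one_third_le_LFunction_two hχ h1))

lemma zeta_mul_three_LFunction_alternating {q₁ q₂ : ℕ} [NeZero q₁] [NeZero q₂]
    {χ₁ : DirichletCharacter ℂ q₁} {χ₂ : DirichletCharacter ℂ q₂}
    {ψ : DirichletCharacter ℂ (q₁ * q₂)}
    (h₁ : χ₁.IsQuadratic) (h₂ : χ₂.IsQuadratic) (hψ : ∀ n : ℕ, ψ n = χ₁ n * χ₂ n)
    (hL : 0 ≤ riemannZeta 2 * (LFunction χ₁ 2 * LFunction χ₂ 2 * LFunction ψ 2)) (m : ℕ) :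
    0 ≤ (-1) ^ m * iteratedDeriv m
      (fun s ↦ riemannZeta s * (LFunction χ₁ s * LFunction χ₂ s * LFunction ψ s)) 2 := by
  have hs₀ {s : ℂ} (hs : 1 < s.re) :=
    LSeriesSummable_twist_vonMangoldt (1 : DirichletCharacter ℂ 1) hs
  have hs₁ {s : ℂ} (hs : 1 < s.re) := LSeriesSummable_twist_vonMangoldt χ₁ hs
  have hs₂ {s : ℂ} (hs : 1 < s.re) := LSeriesSummable_twist_vonMangoldt χ₂ hs
  have hs₃ {s : ℂ} (hs : 1 < s.re) := LSeriesSummable_twist_vonMangoldt ψ hs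
  refine neg_one_pow_mul_iteratedDeriv_nonneg
    (v := twistedLambda (1 : DirichletCharacter ℂ 1) + twistedLambda χ₁ + twistedLambda χ₂ +
      twistedLambda ψ) (fun n ↦ ?_)
    (fun s hs ↦ (((hs₀ hs).add (hs₁ hs)).add (hs₂ hs)).add (hs₃ hs)) (fun s hs ↦ ?_) hL m
  · have h := mul_nonneg (mul_nonneg (one_add_quadratic_nonneg h₁ (n : ZMod q₁))
      (one_add_quadratic_nonneg h₂ (n : ZMod q₂)))
      (zero_le_real.mpr (ArithmeticFunction.vonMangoldt_nonneg (n := n)))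
    have e : (1 + χ₁ n) * (1 + χ₂ n) * (Λ n : ℂ)
        = Λ n + χ₁ n * Λ n + χ₂ n * Λ n + χ₁ n * χ₂ n * Λ n := by ring
    rw [e] at h
    simpa [Subsingleton.elim (n : ZMod 1) 1, hψ] using h
  · rw [LSeries_add (((hs₀ hs).add (hs₁ hs)).add (hs₂ hs)) (hs₃ hs),
      LSeries_add ((hs₀ hs).add (hs₁ hs)) (hs₂ hs), LSeries_add (hs₀ hs) (hs₁ hs)]
    refine ((hasDerivAt_riemannZeta hs).mul (((hasDerivAt_LFunction χ₁ hs).mul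
      (hasDerivAt_LFunction χ₂ hs)).mul (hasDerivAt_LFunction ψ hs))).congr_deriv ?_
    simp only [Pi.mul_apply]
    ring

lemma isQuadratic_of_natCast_mul {q₁ q₂ : ℕ} [NeZero q₁] [NeZero q₂]
    {χ₁ : DirichletCharacter ℂ q₁} {χ₂ : DirichletCharacter ℂ q₂}
    {ψ : DirichletCharacter ℂ (q₁ * q₂)}
    (h₁ : χ₁.IsQuadratic) (h₂ : χ₂.IsQuadratic) (hψ : ∀ n : ℕ, ψ n = χ₁ n * χ₂ n) :
    ψ.IsQuadratic := by
  intro a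
  rw [← ZMod.natCast_zmod_val a, hψ]
  rcases h₁ (a.val : ZMod q₁) with h | h | h <;>
    rcases h₂ (a.val : ZMod q₂) with h' | h' | h' <;> rw [h, h'] <;> simp

lemma LFunction_pos_of_no_zero {q : ℕ} [NeZero q] {χ : DirichletCharacter ℂ q}
    (hχ : χ.IsQuadratic) (h1 : χ ≠ 1) {a : ℝ} (ha : 1 / 2 < a) (ha1 : a < 1)
    (hz : ∀ σ : ℝ, a ≤ σ → σ < 1 → LFunction χ σ ≠ 0) : 0 < (LFunction χ a).re := by
  by_contra! hneg
  have hc : ContinuousOn (fun σ : ℝ ↦ (LFunction χ σ).re) (Set.Icc a 2) :=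
    (continuous_re.comp ((differentiable_LFunction h1).continuous.comp
      continuous_ofReal)).continuousOn
  have h2 : 0 ≤ (LFunction χ (2 : ℝ)).re := by
    have := (Complex.le_def.mp (one_third_le_LFunction_two hχ h1)).1
    refine le_trans ?_ this
    norm_num
  obtain ⟨σ, hσ, h0⟩ := intermediate_value_Icc (by linarith : a ≤ 2) hc ⟨hneg, h2⟩
  have h3 : LFunction χ σ = 0 :=
    Complex.ext h0 (LFunction_im_eq_zero hχ h1 (by linarith [hσ.1]))
  rcases lt_or_ge σ 1 with h | h
  · exact hz σ hσ.1 h h3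
  · exact LFunction_ne_zero_of_one_le_re χ (.inl h1) (by simpa using h) h3

lemma norm_LFunction_one_ge_of_no_zero : ∃ ε₀ : ℝ, 0 < ε₀ ∧ ε₀ ≤ 1 / 8 ∧ ∀ ε : ℝ, 0 < ε → ε ≤ ε₀ →
    (∀ (q : ℕ) [NeZero q] (χ : DirichletCharacter ℂ q), χ.IsQuadratic → χ ≠ 1 →
      ∀ σ : ℝ, 1 - ε ≤ σ → σ < 1 → LFunction χ σ ≠ 0) →
    ∃ c : ℝ, 0 < c ∧ ∀ (q : ℕ) [NeZero q] (χ : DirichletCharacter ℂ q), χ.IsQuadratic → χ ≠ 1 →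
      c * (q : ℝ) ^ (-(7 * ε)) ≤ ‖LFunction χ 1‖ := by
  have hcont : ContinuousAt (fun σ : ℝ ↦ (riemannZeta₁ σ).re) 1 :=
    (continuous_re.comp (differentiable_riemannZeta₁.continuous.comp
      continuous_ofReal)).continuousAt
  have hev : ∀ᶠ σ : ℝ in 𝓝 1, 0 < (riemannZeta₁ σ).re :=
    hcont.eventually_const_lt (by simp)
  obtain ⟨r, hr, hball⟩ := Metric.eventually_nhds_iff.mp hev
  obtain ⟨c, hc, hP⟩ := norm_apply_one_ge (b := 1 / 3) (by norm_num)
  obtain ⟨C, hC, hCL⟩ := norm_LFunction_sphere_le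
  refine ⟨min (1 / 8) (r / 2), by positivity, min_le_left _ _, fun ε hε hε₀ hz ↦ ?_⟩
  have hε1 : ε ≤ 1 / 8 := hε₀.trans (min_le_left _ _)
  have hε2 : ε ≤ r / 2 := hε₀.trans (min_le_right _ _)
  refine ⟨c * ε * C ^ (-(7 * ε)), by positivity, fun q _ χ hχ h1 ↦ ?_⟩
  have hq : (1 : ℝ) ≤ q := by exact_mod_cast Nat.pos_of_neZero q
  have h2 : ((1 / 3 : ℝ) : ℂ) ≤ riemannZeta 2 * LFunction χ 2 := by
    have := mul_le_mul one_le_riemannZeta_two (one_third_le_LFunction_two hχ h1)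
      (zero_le_real.mpr (by norm_num)) (zero_le_one.trans one_le_riemannZeta_two)
    rwa [one_mul] at this
  have hpos := LFunction_pos_of_no_zero hχ h1 (a := 1 - ε) (by linarith) (by linarith)
    (hz q χ hχ h1)
  have him := LFunction_im_eq_zero hχ h1 (σ := 1 - ε) (by linarith)
  have hζ : (riemannZeta ((1 - ε : ℝ) : ℂ)).re ≤ 0 := by
    have hne : ((1 - ε : ℝ) : ℂ) ≠ 1 := by
      rw [Ne, ofReal_eq_one]; linarith
    have h3 : 0 < (riemannZeta₁ ((1 - ε : ℝ) : ℂ)).re := by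
      refine hball ?_
      rw [Real.dist_eq, sub_sub_cancel_left, abs_neg, abs_of_pos hε]
      linarith
    rw [riemannZeta_eq_inv_sub_mul hne, show ((1 - ε : ℝ) : ℂ) - 1 = ((-ε : ℝ) : ℂ) by
      push_cast; ring, ← ofReal_inv, re_ofReal_mul]
    exact mul_nonpos_of_nonpos_of_nonneg (inv_nonpos.mpr (by linarith)) h3.le
  have key := hP (LFunction χ) (differentiable_LFunction h1) (C * q) (by nlinarith)
    (hCL q χ h1) (fun m ↦ (Complex.le_def.mp (zeta_mul_LFunction_alternating hχ h1 m)).1)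
    (by simpa using (Complex.le_def.mp h2).1) (1 - ε) (by linarith) (by linarith) (by
      rw [mul_re, him, mul_zero, sub_zero]
      exact mul_nonpos_of_nonpos_of_nonneg hζ hpos.le)
  rw [sub_sub_cancel, Real.mul_rpow (by linarith) (by linarith)] at key
  linarith

lemma norm_LFunction_one_ge_of_zero {q₁ : ℕ} [NeZero q₁] {χ₁ : DirichletCharacter ℂ q₁}
    (h₁ : χ₁.IsQuadratic) (hne₁ : χ₁ ≠ 1) {κ : ℝ} (hκ : 0 < κ) (hκ1 : κ ≤ 1 / 8)
    (hzero : LFunction χ₁ (1 - κ : ℝ) = 0) :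
    ∃ c : ℝ, 0 < c ∧ ∀ (q : ℕ) [NeZero q] (χ : DirichletCharacter ℂ q), χ.IsQuadratic → χ ≠ 1 →
      χ₁.conductor ≠ χ.conductor → c * (q : ℝ) ^ (-(15 * κ)) ≤ ‖LFunction χ 1‖ := by
  obtain ⟨c, hc, hP⟩ := norm_apply_one_ge (b := 1 / 27) (by norm_num)
  obtain ⟨C, hC, hCL⟩ := norm_LFunction_sphere_le
  obtain ⟨C', hC', hC'L⟩ := norm_LFunction_le hκ (by linarith)
  have ha : 0 < ‖LFunction χ₁ 1‖ := norm_pos_iff.mpr (LFunction_apply_one_ne_zero hne₁)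
  have hq₁ : (1 : ℝ) ≤ q₁ := by exact_mod_cast Nat.pos_of_neZero q₁
  refine ⟨c * κ * (C ^ 3 * q₁ ^ 2) ^ (-(7 * κ)) / (‖LFunction χ₁ 1‖ * (C' * (2 * q₁) ^ κ)),
    by positivity, fun q _ χ hχ hne hcond ↦ ?_⟩
  have hq : (1 : ℝ) ≤ q := by exact_mod_cast Nat.pos_of_neZero q
  obtain ⟨ψ, hψ1, hψ⟩ := exists_mul_character hcond
  have hψq := isQuadratic_of_natCast_mul h₁ hχ hψ
  have h2 : ((1 / 27 : ℝ) : ℂ) ≤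
      riemannZeta 2 * (LFunction χ₁ 2 * LFunction χ 2 * LFunction ψ 2) := by
    have h3 : (0 : ℂ) ≤ ((1 / 3 : ℝ) : ℂ) := zero_le_real.mpr (by norm_num)
    have e1 := one_third_le_LFunction_two h₁ hne₁
    have e2 := one_third_le_LFunction_two hχ hne
    have e3 := one_third_le_LFunction_two hψq hψ1
    have := mul_le_mul one_le_riemannZeta_two (mul_le_mul (mul_le_mul e1 e2 h3 (h3.trans e1)) e3 h3
      (mul_nonneg (h3.trans e1) (h3.trans e2))) (mul_nonneg (mul_nonneg h3 h3) h3)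
      (zero_le_one.trans one_le_riemannZeta_two)
    refine le_trans (le_of_eq ?_) this
    norm_num
  have h0 : (0 : ℂ) ≤ ((1 / 27 : ℝ) : ℂ) := zero_le_real.mpr (by norm_num)
  have key := hP (fun s ↦ LFunction χ₁ s * LFunction χ s * LFunction ψ s)
    (((differentiable_LFunction hne₁).mul (differentiable_LFunction hne)).mul
      (differentiable_LFunction hψ1)) (C ^ 3 * q₁ ^ 2 * q ^ 2) ?_ ?_
    (fun m ↦ (Complex.le_def.mp
      (zeta_mul_three_LFunction_alternating h₁ hχ hψ (h0.trans h2) m)).1)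
    (by simpa using (Complex.le_def.mp h2).1) (1 - κ) (by linarith) (by linarith)
    (by simp only [hzero, zero_mul, mul_zero]; simp)
  · have hψle : ‖LFunction ψ 1‖ ≤ C' * (2 * q₁) ^ κ * q ^ κ := by
      refine (hC'L _ ψ hψ1 1 (by simp; linarith)).trans (le_of_eq ?_)
      rw [mul_assoc, ← Real.mul_rpow (by positivity) (by positivity)]
      congr 2
      push_cast
      norm_num
      ring
    rw [sub_sub_cancel, Real.mul_rpow (by positivity) (by positivity), norm_mul, norm_mul] at key
    rw [div_mul_eq_mul_div, div_le_iff₀ (by positivity)]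
    have e1 : (q : ℝ) ^ (-(15 * κ)) * q ^ κ = ((q : ℝ) ^ 2) ^ (-(7 * κ)) := by
      rw [← Real.rpow_natCast, ← Real.rpow_mul (by positivity), ← Real.rpow_add (by positivity)]
      congr 1
      push_cast
      ring
    have hqκ : 0 < (q : ℝ) ^ κ := by positivity
    refine le_of_mul_le_mul_right ?_ hqκ
    calc _ = c * κ * ((C ^ 3 * q₁ ^ 2) ^ (-(7 * κ)) * ((q : ℝ) ^ 2) ^ (-(7 * κ))) := by
          rw [← e1]; ring
      _ ≤ ‖LFunction χ₁ 1‖ * ‖LFunction χ 1‖ * ‖LFunction ψ 1‖ := key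
      _ ≤ ‖LFunction χ₁ 1‖ * ‖LFunction χ 1‖ * (C' * (2 * q₁) ^ κ * q ^ κ) := by gcongr
      _ = _ := by ring
  · have e1 : 1 ≤ C ^ 3 := one_le_pow₀ hC
    have e2 : (1 : ℝ) ≤ (q₁ : ℝ) ^ 2 := one_le_pow₀ hq₁
    have e3 : (1 : ℝ) ≤ (q : ℝ) ^ 2 := one_le_pow₀ hq
    exact one_le_mul_of_one_le_of_one_le (one_le_mul_of_one_le_of_one_le e1 e2) e3
  · intro z hz
    rw [norm_mul, norm_mul]
    calc _ ≤ (C * q₁) * (C * q) * (C * ((q₁ * q : ℕ) : ℝ)) := by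
          gcongr
          · exact hCL _ _ hne₁ z hz
          · exact hCL _ _ hne z hz
          · exact hCL _ _ hψ1 z hz
      _ = _ := by push_cast; ring

lemma exists_norm_LFunction_one_ge_level (d : ℕ) [NeZero d] : ∃ c : ℝ, 0 < c ∧
    ∀ χ : DirichletCharacter ℂ d, χ ≠ 1 → c ≤ ‖LFunction χ 1‖ := by
  rcases isEmpty_or_nonempty {χ : DirichletCharacter ℂ d // χ ≠ 1} with h | h
  · exact ⟨1, one_pos, fun χ hχ ↦ h.elim ⟨χ, hχ⟩⟩
  · obtain ⟨χ₀, h₀⟩ := Finite.exists_min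
      (fun χ : {χ : DirichletCharacter ℂ d // χ ≠ 1} ↦ ‖LFunction χ.1 1‖)
    exact ⟨_, norm_pos_iff.mpr (LFunction_apply_one_ne_zero χ₀.2), fun χ hχ ↦ h₀ ⟨χ, hχ⟩⟩

/-- Siegel's theorem. -/
theorem norm_LFunction_one_ge {ε : ℝ} (hε : 0 < ε) : ∃ c : ℝ, 0 < c ∧
    ∀ (q : ℕ) [NeZero q] (χ : DirichletCharacter ℂ q), χ.IsPrimitive → χ.IsQuadratic → χ ≠ 1 →
      c * (q : ℝ) ^ (-ε) ≤ ‖LFunction χ 1‖ := by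
  obtain ⟨ε₀, hε₀, hε₀1, hA⟩ := norm_LFunction_one_ge_of_no_zero
  set η := min ε₀ (ε / 15) with hη
  have hη0 : 0 < η := by positivity
  have hη1 : η ≤ ε / 15 := min_le_right _ _
  have hpow (q : ℕ) [NeZero q] {a : ℝ} (ha : a ≤ ε) : (q : ℝ) ^ (-ε) ≤ (q : ℝ) ^ (-a) := by
    refine Real.rpow_le_rpow_of_exponent_le ?_ (by linarith)
    exact_mod_cast Nat.pos_of_neZero q
  by_cases hz : ∀ (q : ℕ) [NeZero q] (χ : DirichletCharacter ℂ q), χ.IsQuadratic → χ ≠ 1 →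
      ∀ σ : ℝ, 1 - η ≤ σ → σ < 1 → LFunction χ σ ≠ 0
  · obtain ⟨c, hc, h⟩ := hA η hη0 (min_le_left _ _) hz
    refine ⟨c, hc, fun q _ χ _ hχ h1 ↦ le_trans ?_ (h q χ hχ h1)⟩
    exact mul_le_mul_of_nonneg_left (hpow q (a := 7 * η) (by linarith)) hc.le
  · push Not at hz
    obtain ⟨q₁, _, χ₁, h₁, hne₁, σ, hσ, hσ1, h0⟩ := hz
    have hσ2 : 1 - σ ≤ η := by linarith
    obtain ⟨c, hc, h⟩ := norm_LFunction_one_ge_of_zero h₁ hne₁ (κ := 1 - σ) (by linarith)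
      (hσ2.trans ((min_le_left _ _).trans hε₀1)) (by rwa [sub_sub_cancel])
    have : NeZero χ₁.conductor := ⟨χ₁.conductor_ne_zero⟩
    obtain ⟨c', hc', h'⟩ := exists_norm_LFunction_one_ge_level χ₁.conductor
    refine ⟨min c c', by positivity, fun q _ χ hprim hχ h1 ↦ ?_⟩
    by_cases hcond : χ₁.conductor = q
    · subst hcond
      refine le_trans ?_ (h' χ h1)
      have hq : (1 : ℝ) ≤ χ₁.conductor := by exact_mod_cast Nat.pos_of_neZero χ₁.conductor
      have := Real.rpow_le_one_of_one_le_of_nonpos hq (by linarith : -ε ≤ 0)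
      calc _ ≤ c' * 1 := by
            gcongr
            exact min_le_right _ _
        _ = c' := mul_one _
    · refine le_trans ?_ (h q χ hχ h1 (by rwa [(isPrimitive_def χ).mp hprim]))
      exact mul_le_mul (min_le_left _ _) (hpow q (a := 15 * (1 - σ)) (by linarith))
        (by positivity) hc.le

end SiegelBound

section LowerBound

open Complex DirichletCharacter

lemma exists_norm_LFunction_sub_le {ε : ℝ} (hε : 0 < ε) (hε1 : ε < 1) :
    ∃ D : ℝ, 0 < D ∧ ∀ (q : ℕ) [NeZero q] (χ : DirichletCharacter ℂ q), χ ≠ 1 →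
      ∀ (T : ℝ) (s w : ℂ), 1 ≤ s.re → s.re ≤ 2 → 1 ≤ w.re → w.re ≤ 2 → |s.im| ≤ T → |w.im| ≤ T →
        ‖LFunction χ s - LFunction χ w‖ ≤ D * (q * (2 + T)) ^ ε * ‖s - w‖ := by
  obtain ⟨D, hD, h⟩ := norm_iteratedDeriv_LFunction_le hε hε1 1
  refine ⟨D, hD, fun q _ χ hχ T s w hs1 hs2 hw1 hw2 hsT hwT ↦ ?_⟩
  have hconv : Convex ℝ ({z : ℂ | 1 ≤ z.re} ∩ {z : ℂ | z.re ≤ 2} ∩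
      ({z : ℂ | -T ≤ z.im} ∩ {z : ℂ | z.im ≤ T})) :=
    ((convex_halfSpace_re_ge 1).inter (convex_halfSpace_re_le 2)).inter
      ((convex_halfSpace_im_ge (-T)).inter (convex_halfSpace_im_le T))
  refine hconv.norm_image_sub_le_of_norm_deriv_le (f := LFunction χ)
    (fun z _ ↦ (differentiable_LFunction hχ) z) (fun z hz ↦ ?_)
    ⟨⟨hw1, hw2⟩, abs_le.mp hwT⟩ ⟨⟨hs1, hs2⟩, abs_le.mp hsT⟩
  have := h q χ hχ z hz.1.1 hz.1.2
  rw [iteratedDeriv_one] at this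
  have hzT : |z.im| ≤ T := abs_le.mpr hz.2
  exact this.trans (by gcongr)

lemma lower_bound_of_pow_four {f : ℝ → ℂ} {B c D : ℝ} (hB : 1 ≤ B) (hc : 0 < c) (hcD : c ≤ D)
    (hf : ∀ σ σ' : ℝ, 1 < σ → σ ≤ σ' → σ' ≤ 2 → ‖f σ' - f σ‖ ≤ D * B * (σ' - σ))
    (h4 : ∀ σ : ℝ, 1 < σ → σ ≤ 2 → (c / B) ^ 4 * (σ - 1) ^ 3 ≤ ‖f σ‖ ^ 4)
    {σ : ℝ} (hσ : 1 < σ) (hσ2 : σ ≤ 2) :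
    (c / (2 * D)) ^ 3 * (c / 2) / B ^ 7 ≤ ‖f σ‖ := by
  have hD : 0 < D := hc.trans_le hcD
  set y := c / (2 * D * B ^ 2) with hy
  have hy0 : 0 < y := by positivity
  have hy1 : y ≤ 1 := by
    rw [hy, div_le_one (by positivity)]
    nlinarith [one_le_pow₀ hB (n := 2)]
  have hkey (σ' : ℝ) (h1 : 1 + y ^ 4 ≤ σ') (h2 : σ' ≤ 2) : y ^ 3 * (c / B) ≤ ‖f σ'‖ := by
    refine le_of_pow_le_pow_left₀ (n := 4) (by norm_num) (by positivity) ?_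
    refine le_trans ?_ (h4 σ' (by linarith [pow_pos hy0 4]) h2)
    have : y ^ 4 ≤ σ' - 1 := by linarith
    calc (y ^ 3 * (c / B)) ^ 4 = (c / B) ^ 4 * (y ^ 4) ^ 3 := by ring
      _ ≤ _ := by gcongr
  have heq : y ^ 3 * (c / B) = 2 * ((c / (2 * D)) ^ 3 * (c / 2) / B ^ 7) := by
    rw [hy]; field_simp
  have hpos : 0 ≤ (c / (2 * D)) ^ 3 * (c / 2) / B ^ 7 := by positivity
  rcases le_total (1 + y ^ 4) σ with h | h
  · have := hkey σ h hσ2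
    linarith
  · have h2 : 1 + y ^ 4 ≤ 2 := by linarith [pow_le_one₀ hy0.le hy1 (n := 4)]
    have h3 := hkey _ le_rfl h2
    have h5 := hf σ _ hσ h h2
    have h6 : D * B * (1 + y ^ 4 - σ) ≤ (c / (2 * D)) ^ 3 * (c / 2) / B ^ 7 := by
      calc D * B * (1 + y ^ 4 - σ) ≤ D * B * y ^ 4 := by gcongr; linarith
        _ = _ := by rw [hy]; field_simp
    have h7 := norm_sub_norm_le (f (1 + y ^ 4)) (f σ)
    linarith

lemma exists_pow_four_le {ε : ℝ} (hε : 0 < ε) (hε1 : ε < 1) :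
    ∃ C : ℝ, 1 ≤ C ∧ ∀ (q : ℕ) [NeZero q] (χ : DirichletCharacter ℂ q) (x t : ℝ), 0 < x → x ≤ 1 →
      x ^ 3 ≤ (C * (q * (2 + |t|)) ^ ε) ^ 3 * ‖LFunction χ (1 + x + I * t)‖ ^ 4 *
        ‖LFunction (χ ^ 2) (1 + x + 2 * I * t)‖ := by
  obtain ⟨C, hC, h⟩ := norm_LFunction_one_le hε hε1.le
  refine ⟨3 * C + 1, by linarith, fun q _ χ x t hx hx1 ↦ ?_⟩
  have hq : (1 : ℝ) ≤ q := by exact_mod_cast Nat.pos_of_neZero q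
  have hN : (1 : ℝ) ≤ q * (2 + |t|) := by nlinarith [abs_nonneg t]
  have hB := Real.one_le_rpow hN hε.le
  set B := (q * (2 + |t|) : ℝ) ^ ε with hBdef
  have h1 : ‖LFunctionTrivChar q (1 + x)‖ ≤ (3 * C + 1) * B / x := by
    refine (h q (1 + x) (by simpa)).trans ?_
    have e1 : ‖(1 : ℂ) + x - 1‖ = x := by
      rw [add_sub_cancel_left, Complex.norm_real, Real.norm_of_nonneg hx.le]
    have e2 : ‖(1 : ℂ) + x‖ ≤ 2 := by
      refine (norm_add_le _ _).trans ?_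
      rw [Complex.norm_real, Real.norm_of_nonneg hx.le, norm_one]; linarith
    have e3 : (q * (1 + ‖(1 : ℂ) + x‖) : ℝ) ^ ε ≤ 3 * B := by
      calc (q * (1 + ‖(1 : ℂ) + x‖) : ℝ) ^ ε ≤ (3 * (q * (2 + |t|))) ^ ε := by
            apply Real.rpow_le_rpow (by positivity) _ hε.le
            nlinarith [abs_nonneg t]
        _ = 3 ^ ε * B := Real.mul_rpow (by norm_num) (by positivity)
        _ ≤ 3 * B := by
            gcongr
            calc (3 : ℝ) ^ ε ≤ 3 ^ (1 : ℝ) :=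
                  Real.rpow_le_rpow_of_exponent_le (by norm_num) hε1.le
              _ = 3 := Real.rpow_one 3
    rw [e1, le_div_iff₀ hx, add_mul, one_div_mul_cancel hx.ne']
    calc C * (q * (1 + ‖(1 : ℂ) + x‖) : ℝ) ^ ε * x + 1 ≤ C * (3 * B) * 1 + B := by gcongr
      _ = _ := by ring
  have h2 := χ.norm_LFunction_product_ge_one hx t
  rw [norm_mul, norm_mul, norm_pow, norm_pow] at h2
  calc x ^ 3 = x ^ 3 * 1 := (mul_one _).symm
    _ ≤ x ^ 3 * (((3 * C + 1) * B / x) ^ 3 * ‖LFunction χ (1 + x + I * t)‖ ^ 4 *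
        ‖LFunction (χ ^ 2) (1 + x + 2 * I * t)‖) := by
          gcongr
          refine h2.le.trans ?_
          gcongr
    _ = _ := by field_simp

lemma exists_norm_LFunction_sq_le {ε : ℝ} (hε : 0 < ε) (hε1 : ε < 1) :
    ∃ C : ℝ, 1 ≤ C ∧ ∀ (q : ℕ) [NeZero q] (χ : DirichletCharacter ℂ q) (x t : ℝ), 0 < x → x ≤ 1 →
      (χ ≠ 1 → ‖LFunction χ (1 + x + 2 * I * t)‖ ≤ C * (q * (2 + |t|)) ^ ε) ∧
      (χ = 1 → ‖LFunction χ (1 + x + 2 * I * t)‖ ≤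
        C * (q * (2 + |t|)) ^ ε + 1 / ‖x + 2 * I * t‖) := by
  obtain ⟨C, hC, h⟩ := norm_LFunction_one_le hε hε1.le
  obtain ⟨C', hC', h'⟩ := norm_LFunction_le hε hε1
  refine ⟨1 + (C + C') * 4 ^ ε, by linarith [show 0 < (C + C') * 4 ^ ε by positivity],
    fun q _ χ x t hx hx1 ↦ ?_⟩
  have hs1 : (1 + x + 2 * I * t : ℂ).re = 1 + x := by simp
  have hs2 : (1 + x + 2 * I * t : ℂ).im = 2 * t := by simp
  have h0 := one_add_norm_le (s := 1 + x + 2 * I * t) (by linarith) (by linarith)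
  rw [hs2, abs_mul, abs_two] at h0
  have h1 : (q * (1 + ‖(1 + x + 2 * I * t : ℂ)‖) : ℝ) ^ ε ≤ 4 ^ ε * (q * (2 + |t|)) ^ ε := by
    rw [← Real.mul_rpow (by norm_num) (by positivity)]
    apply Real.rpow_le_rpow (by positivity) _ hε.le
    nlinarith [abs_nonneg t, (Nat.cast_nonneg q : (0 : ℝ) ≤ q),
      mul_le_mul_of_nonneg_left h0 (Nat.cast_nonneg q : (0 : ℝ) ≤ q)]
  have hP : 0 ≤ (q * (2 + |t|) : ℝ) ^ ε := by positivity
  refine ⟨fun hχ ↦ ?_, fun hχ ↦ ?_⟩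
  · refine (h' q χ hχ _ (by rw [hs1]; linarith)).trans ?_
    calc _ ≤ C' * (4 ^ ε * (q * (2 + |t|)) ^ ε) := by gcongr
      _ ≤ _ := by nlinarith [show 0 ≤ C * (4 ^ ε * (q * (2 + |t|) : ℝ) ^ ε) by positivity]
  · subst hχ
    refine (h q _ (by rw [hs1]; linarith)).trans ?_
    rw [show (1 + x + 2 * I * t : ℂ) - 1 = x + 2 * I * t by ring]
    gcongr ?_ + _
    calc _ ≤ C * (4 ^ ε * (q * (2 + |t|)) ^ ε) := by gcongr
      _ ≤ _ := by nlinarith [show 0 ≤ C' * (4 ^ ε * (q * (2 + |t|) : ℝ) ^ ε) by positivity]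

lemma norm_LFunction_ge_of_sq_le {C₁ C₂ D B x t : ℝ} {q : ℕ} {χ : DirichletCharacter ℂ q}
    (hC₁ : 1 ≤ C₁) (hC₂ : 1 ≤ C₂) (hD : 1 ≤ D) (hB : 1 ≤ B) [NeZero q]
    (hpow : ∀ x : ℝ, 0 < x → x ≤ 1 → x ^ 3 ≤ (C₁ * B) ^ 3 *
      ‖LFunction χ (1 + x + I * t)‖ ^ 4 * ‖LFunction (χ ^ 2) (1 + x + 2 * I * t)‖)
    (hsq : ∀ x : ℝ, 0 < x → x ≤ 1 → ‖LFunction (χ ^ 2) (1 + x + 2 * I * t)‖ ≤ C₂ * B ^ 2)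
    (hlip : ∀ σ σ' : ℝ, 1 < σ → σ ≤ σ' → σ' ≤ 2 →
      ‖LFunction χ (σ' + I * t) - LFunction χ (σ + I * t)‖ ≤ D * B * (σ' - σ))
    (hx : 0 < x) (hx1 : x ≤ 1) :
    (1 / (C₁ * C₂) / (2 * D)) ^ 3 * (1 / (C₁ * C₂) / 2) / B ^ 14 ≤
      ‖LFunction χ (1 + x + I * t)‖ := by
  have hC1 : 0 < C₁ := by linarith
  have hC2 : 0 < C₂ := by linarith
  have hB0 : 0 < B := by linarith
  have := lower_bound_of_pow_four (f := fun σ ↦ LFunction χ (σ + I * t)) (B := B ^ 2)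
    (c := 1 / (C₁ * C₂)) (D := D) (one_le_pow₀ hB) (by positivity)
    ((div_le_one (by positivity)).mpr (one_le_mul_of_one_le_of_one_le hC₁ hC₂) |>.trans hD)
    (fun σ σ' h1 h2 h3 ↦ (hlip σ σ' h1 h2 h3).trans ?_) (fun σ h1 h2 ↦ ?_) (σ := 1 + x)
    (by linarith) (by linarith)
  · rw [← pow_mul] at this
    simpa using this
  · gcongr
    exact le_self_pow₀ hB two_ne_zero
  · have e := hpow (σ - 1) (by linarith) (by linarith)
    have e' := hsq (σ - 1) (by linarith) (by linarith)
    have hσ : (1 : ℂ) + ((σ - 1 : ℝ) : ℂ) = σ := by push_cast; ring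
    rw [hσ] at e e'
    set F := ‖LFunction χ (σ + I * t)‖ ^ 4 with hF
    have hF0 : 0 ≤ F := by positivity
    have h5 : (σ - 1) ^ 3 ≤ (C₁ * C₂) ^ 4 * B ^ 8 * F := by
      calc (σ - 1) ^ 3 ≤ (C₁ * B) ^ 3 * F * (C₂ * B ^ 2) := by
            refine e.trans ?_
            gcongr
        _ = (C₁ ^ 3 * C₂ ^ 1) * B ^ 5 * F := by ring
        _ ≤ (C₁ ^ 4 * C₂ ^ 4) * B ^ 8 * F := by
            gcongr
            all_goals first | assumption | norm_num
        _ = _ := by ring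
    calc (1 / (C₁ * C₂) / B ^ 2) ^ 4 * (σ - 1) ^ 3
        ≤ (1 / (C₁ * C₂) / B ^ 2) ^ 4 * ((C₁ * C₂) ^ 4 * B ^ 8 * F) := by gcongr
      _ = F := by field_simp

theorem norm_LFunction_ge {ε : ℝ} (hε : 0 < ε) : ∃ c : ℝ, 0 < c ∧
    ∀ (q : ℕ) [NeZero q] (χ : DirichletCharacter ℂ q), χ.IsPrimitive → χ ≠ 1 →
      ∀ s : ℂ, 1 < s.re → s.re ≤ 2 →
        c * (q * (2 + |s.im|)) ^ (-ε) ≤ ‖LFunction χ s‖ := by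
  set κ := min (ε / 14) (1 / 2) with hκ
  have hκ0 : 0 < κ := by positivity
  have hκ1 : κ < 1 := (min_le_right _ _).trans_lt (by norm_num)
  have hκε : 14 * κ ≤ ε := by linarith [min_le_left (ε / 14) (1 / 2)]
  obtain ⟨D', hD', hlip⟩ := exists_norm_LFunction_sub_le hκ0 hκ1
  obtain ⟨C₁, hC₁, hpow⟩ := exists_pow_four_le hκ0 hκ1
  obtain ⟨C₂, hC₂, hsq⟩ := exists_norm_LFunction_sq_le hκ0 hκ1
  obtain ⟨c, hc, hSiegel⟩ := norm_LFunction_one_ge hκ0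
  set D := 1 + D' with hD
  set r := c / (4 * D) with hr
  have hD0 : 0 < D := by positivity
  have hr0 : 0 < r := by positivity
  set C₃ := C₂ + 1 / (2 * r) with hC₃
  have hC₃' : C₂ ≤ C₃ := le_add_of_nonneg_right (by positivity)
  set c₀ := (1 / (C₁ * C₃) / (2 * D)) ^ 3 * (1 / (C₁ * C₃) / 2) with hc₀
  have hc₀' : 0 < c₀ := by
    have : 0 < C₁ := by linarith
    have : 0 < C₃ := by linarith
    positivity
  have hC10 : 0 < C₁ := by linarith
  have hC20 : 0 < C₂ := by linarith
  refine ⟨min c₀ (min (r / (C₁ * (C₂ + 1))) (c / 2)), by positivity,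
    fun q _ χ hprim hχ s hs1 hs2 ↦ ?_⟩
  set t := s.im with ht
  set x := s.re - 1 with hx
  have hx0 : 0 < x := by linarith
  have hx1 : x ≤ 1 := by linarith
  have hs : s = 1 + x + I * t := by
    apply Complex.ext <;> simp [hx, ht]
  have hq : (1 : ℝ) ≤ q := by exact_mod_cast Nat.pos_of_neZero q
  have hqN : (q : ℝ) ≤ q * (2 + |t|) := by nlinarith [abs_nonneg t]
  have hN : (1 : ℝ) ≤ q * (2 + |t|) := hq.trans hqN
  have hB := Real.one_le_rpow hN hκ0.le
  have hBpow (n : ℕ) (hn : n ≤ 14) :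
      (q * (2 + |t|) : ℝ) ^ (-ε) ≤ 1 / ((q * (2 + |t|) : ℝ) ^ κ) ^ n := by
    rw [← Real.rpow_natCast, ← Real.rpow_mul (by positivity), one_div, ← Real.rpow_neg
      (by positivity)]
    apply Real.rpow_le_rpow_of_exponent_le hN
    have : (n : ℝ) ≤ 14 := by exact_mod_cast hn
    nlinarith
  have hlip' := hlip q χ hχ |t|
  have hpow' (x : ℝ) := hpow q χ x t
  have hsq' (x : ℝ) := hsq q (χ ^ 2) x t
  have hS : χ ^ 2 = 1 → c * (q : ℝ) ^ (-κ) ≤ ‖LFunction χ 1‖ := fun h ↦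
    hSiegel q χ hprim (MulChar.isQuadratic_iff_sq_eq_one.mpr h) hχ
  have hqB : 1 / ((q * (2 + |t|) : ℝ) ^ κ) ≤ (q : ℝ) ^ (-κ) := by
    rw [one_div, Real.rpow_neg (by positivity)]
    gcongr
  set B := (q * (2 + |t|) : ℝ) ^ κ with hBdef
  have hB0 : 0 < B := by linarith
  have hfin {c' : ℝ} (n : ℕ) (hn : n ≤ 14)
      (hc' : min c₀ (min (r / (C₁ * (C₂ + 1))) (c / 2)) ≤ c') (hc'0 : 0 ≤ c')
      (h : c' / B ^ n ≤ ‖LFunction χ s‖) :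
      min c₀ (min (r / (C₁ * (C₂ + 1))) (c / 2)) * (q * (2 + |t|)) ^ (-ε) ≤ ‖LFunction χ s‖ := by
    refine le_trans ?_ h
    rw [div_eq_mul_one_div c']
    exact mul_le_mul hc' (hBpow n hn) (by positivity) hc'0
  have hmain (h : ∀ x : ℝ, 0 < x → x ≤ 1 →
      ‖LFunction (χ ^ 2) (1 + x + 2 * I * t)‖ ≤ C₃ * B ^ 2) :
      min c₀ (min (r / (C₁ * (C₂ + 1))) (c / 2)) * (q * (2 + |t|)) ^ (-ε) ≤ ‖LFunction χ s‖ := by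
    refine hfin 14 le_rfl (min_le_left _ _) hc₀'.le ?_
    rw [hs]
    refine norm_LFunction_ge_of_sq_le hC₁ (hC₂.trans hC₃') (by linarith) hB hpow' h
      (fun σ σ' h1 h2 h3 ↦ ?_) hx0 hx1
    refine (hlip' (σ' + I * t) (σ + I * t) (by simp; linarith) (by simpa) (by simp; linarith)
      (by simp; linarith) (by simp) (by simp)).trans ?_
    rw [add_sub_add_right_eq_sub, ← ofReal_sub, Complex.norm_real,
      Real.norm_of_nonneg (by linarith)]
    have : 0 ≤ σ' - σ := by linarith
    gcongr
    linarith
  have hBB : B ≤ B ^ 2 := le_self_pow₀ hB two_ne_zero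
  by_cases hχ2 : χ ^ 2 = 1
  swap
  · refine hmain fun x hx hx1 ↦ ((hsq' x hx hx1).1 hχ2).trans ?_
    gcongr
  rcases le_or_gt (r / B ^ 2) |t| with htr | htr
  · refine hmain fun x hx hx1 ↦ ((hsq' x hx hx1).2 hχ2).trans ?_
    have h1 : 2 * (r / B ^ 2) ≤ ‖(x + 2 * I * t : ℂ)‖ := by
      refine le_trans ?_ (Complex.abs_im_le_norm _)
      simpa [abs_mul] using htr
    calc C₂ * B + 1 / ‖(x + 2 * I * t : ℂ)‖ ≤ C₂ * B ^ 2 + 1 / (2 * (r / B ^ 2)) := by gcongr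
      _ = C₃ * B ^ 2 := by rw [hC₃]; field_simp
  rcases le_or_gt (r / B ^ 2) x with hxr | hxr
  · refine hfin 4 (by norm_num) ((min_le_right _ _).trans (min_le_left _ _)) (by positivity) ?_
    have h1 : ‖LFunction (χ ^ 2) (1 + x + 2 * I * t)‖ ≤ (C₂ + 1) * B / x := by
      refine ((hsq' x hx0 hx1).2 hχ2).trans ?_
      have h2 : x ≤ ‖(x + 2 * I * t : ℂ)‖ := by
        refine le_trans ?_ (Complex.re_le_norm _)
        simp
      calc C₂ * B + 1 / ‖(x + 2 * I * t : ℂ)‖ ≤ C₂ * B / x + B / x := by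
            gcongr
            exact le_div_self (by positivity) hx0 hx1
        _ = _ := by ring
    have h2 := hpow' x hx0 hx1
    rw [← hs] at h2
    have h3 : x ^ 4 ≤ (C₁ * (C₂ + 1) * B) ^ 4 * ‖LFunction χ s‖ ^ 4 := by
      calc x ^ 4 = x ^ 3 * x := by ring
        _ ≤ ((C₁ * B) ^ 3 * ‖LFunction χ s‖ ^ 4 * ((C₂ + 1) * B / x)) * x := by
            gcongr
            refine h2.trans ?_
            gcongr
        _ = (C₁ ^ 3 * (C₂ + 1) ^ 1 * B ^ 4) * ‖LFunction χ s‖ ^ 4 := by field_simp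
        _ ≤ (C₁ ^ 4 * (C₂ + 1) ^ 4 * B ^ 4) * ‖LFunction χ s‖ ^ 4 := by
            gcongr
            all_goals first | assumption | linarith
        _ = _ := by ring
    rw [← mul_pow] at h3
    have h4 := le_of_pow_le_pow_left₀ (by norm_num) (by positivity) h3
    have h5 := hxr.trans h4
    rw [div_le_iff₀ (by positivity)] at h5
    rw [div_div, div_le_iff₀ (by positivity)]
    calc r ≤ _ := h5
      _ = ‖LFunction χ s‖ * (C₁ * (C₂ + 1) * B ^ 3) := by ring
      _ ≤ _ := by
          gcongr
          all_goals first | assumption | norm_num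
  · refine hfin 1 (by norm_num) ((min_le_right _ _).trans (min_le_right _ _)) (by positivity) ?_
    have h1 := hlip' 1 s (by simp) (by simp) hs1.le hs2 (by simp) (by simp [ht])
    have h2 : ‖1 - s‖ ≤ 2 * (r / B ^ 2) := by
      rw [hs, show (1 : ℂ) - (1 + x + I * t) = -(x + I * t) by ring, norm_neg]
      refine (norm_add_le _ _).trans ?_
      rw [norm_mul, Complex.norm_I, one_mul, Complex.norm_real, Complex.norm_real,
        Real.norm_of_nonneg hx0.le, Real.norm_eq_abs]
      linarith
    have h3 : D' * B * ‖1 - s‖ ≤ c / 2 / B := by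
      calc D' * B * ‖1 - s‖ ≤ D * B * (2 * (r / B ^ 2)) := by
            gcongr
            linarith
        _ = c / 2 / B := by rw [hr]; field_simp; norm_num
    have h4 : c / B ≤ ‖LFunction χ 1‖ := by
      refine le_trans ?_ (hS hχ2)
      rw [div_eq_mul_one_div]
      gcongr
    have h5 := norm_sub_norm_le (LFunction χ 1) (LFunction χ s)
    have h6 : c / B = c / 2 / B + c / 2 / B := by ring
    rw [pow_one]
    linarith

end LowerBound

section LogDerivative

open Complex DirichletCharacter Finset Filter Topology
open scoped ArithmeticFunction.vonMangoldt

lemma abscissaOfAbsConv_twist_vonMangoldt_lt {q : ℕ} (χ : DirichletCharacter ℂ q) {s : ℂ}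
    (hs : 1 < s.re) : LSeries.abscissaOfAbsConv (twistedLambda χ) < s.re := by
  refine lt_of_le_of_lt (b := ((1 : ℝ) : EReal)) ?_ (by exact_mod_cast hs)
  exact LSeries.abscissaOfAbsConv_le_of_forall_lt_LSeriesSummable fun y hy ↦
    LSeriesSummable_twist_vonMangoldt χ (by simpa using hy)

lemma iteratedDeriv_succ_LFunction {q : ℕ} [NeZero q] (χ : DirichletCharacter ℂ q) (k : ℕ) {s : ℂ}
    (hs : 1 < s.re) :
    iteratedDeriv (k + 1) (LFunction χ) s = -∑ i ∈ range (k + 1), (k.choose i : ℂ) *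
      iteratedDeriv i (LSeries (twistedLambda χ)) s * iteratedDeriv (k - i) (LFunction χ) s := by
  have hO : IsOpen {s : ℂ | 1 < s.re} := isOpen_lt continuous_const continuous_re
  have hm : {s : ℂ | 1 < s.re} ∈ 𝓝 s := hO.mem_nhds hs
  have hFc : ContDiffAt ℂ k (LFunction χ) s := by
    refine DifferentiableOn.contDiffOn (s := {s : ℂ | 1 < s.re}) (fun s hs ↦ ?_) hO |>.contDiffAt hm
    exact (hasDerivAt_LFunction χ hs).differentiableAt.differentiableWithinAt
  have hVc : ContDiffAt ℂ k (LSeries (twistedLambda χ)) s := by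
    refine DifferentiableOn.contDiffOn (s := {s : ℂ | 1 < s.re}) (fun s hs ↦ ?_) hO |>.contDiffAt hm
    exact (LSeries_hasDerivAt
      (abscissaOfAbsConv_twist_vonMangoldt_lt χ hs)).differentiableAt.differentiableWithinAt
  have h1 : deriv (LFunction χ) =ᶠ[𝓝 s] fun s ↦ -(LSeries (twistedLambda χ) s * LFunction χ s) := by
    filter_upwards [hm] with s hs
    rw [(hasDerivAt_LFunction χ hs).deriv, neg_mul]
  rw [iteratedDeriv_succ', h1.iteratedDeriv_eq, iteratedDeriv_fun_neg,
    iteratedDeriv_fun_mul hVc hFc]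

lemma norm_iteratedDeriv_logDeriv_le {ε : ℝ} (hε : 0 < ε) (hε1 : ε < 1) (k : ℕ) :
    ∃ C : ℝ, 0 < C ∧ ∀ (q : ℕ) [NeZero q] (χ : DirichletCharacter ℂ q), χ.IsPrimitive → χ ≠ 1 →
      ∀ s : ℂ, 1 < s.re → s.re ≤ 2 →
        ‖iteratedDeriv k (LSeries (twistedLambda χ)) s‖ ≤ C * (q * (2 + |s.im|)) ^ ε := by
  induction k using Nat.strong_induction_on generalizing ε with
  | _ k ih =>
  have hε3 : 0 < ε / 3 := by positivity
  have hε31 : ε / 3 < 1 := by linarith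
  choose! A hA hAl using norm_iteratedDeriv_LFunction_le hε3 hε31
  choose! G hG hGl using fun (i : ℕ) (hi : i < k) ↦ ih i hi hε3 hε31
  obtain ⟨c, hc, hcl⟩ := norm_LFunction_ge hε3
  have hS : 0 ≤ ∑ i ∈ range k, (k.choose i : ℝ) * G i * A (k - i) := by
    refine sum_nonneg fun i hi ↦ ?_
    have := hG i (by simpa using hi)
    have := hA (k - i)
    positivity
  have hA1 := hA (k + 1)
  refine ⟨(A (k + 1) + ∑ i ∈ range k, (k.choose i : ℝ) * G i * A (k - i)) / c, by positivity,
    fun q _ χ hprim hχ s hs1 hs2 ↦ ?_⟩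
  have hN : (1 : ℝ) ≤ q * (2 + |s.im|) := by
    have hq : (1 : ℝ) ≤ q := by exact_mod_cast Nat.pos_of_neZero q
    nlinarith [abs_nonneg s.im]
  have hB := Real.one_le_rpow hN hε3.le
  have hBε : (q * (2 + |s.im|) : ℝ) ^ ε = ((q * (2 + |s.im|) : ℝ) ^ (ε / 3)) ^ 3 := by
    rw [← Real.rpow_natCast, ← Real.rpow_mul (by positivity)]
    norm_num
  have hcl' := hcl q χ hprim hχ s hs1 hs2
  rw [Real.rpow_neg (by positivity)] at hcl'
  have hA' (j : ℕ) := hAl j q χ hχ s hs1.le hs2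
  have hG' (i : ℕ) (hi : i < k) := hGl i hi q χ hprim hχ s hs1 hs2
  rw [hBε]
  set B := (q * (2 + |s.im|) : ℝ) ^ (ε / 3)
  have hB0 : 0 < B := by linarith
  have h1 := iteratedDeriv_succ_LFunction χ k hs1
  rw [sum_range_succ, Nat.choose_self, Nat.sub_self, iteratedDeriv_zero, Nat.cast_one,
    one_mul] at h1
  have h2 : iteratedDeriv k (LSeries (twistedLambda χ)) s * LFunction χ s =
      -iteratedDeriv (k + 1) (LFunction χ) s - ∑ i ∈ range k, (k.choose i : ℂ) *
        iteratedDeriv i (LSeries (twistedLambda χ)) s * iteratedDeriv (k - i) (LFunction χ) s := by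
    rw [h1]; ring
  have h3 : ‖iteratedDeriv k (LSeries (twistedLambda χ)) s‖ * ‖LFunction χ s‖ ≤
      (A (k + 1) + ∑ i ∈ range k, (k.choose i : ℝ) * G i * A (k - i)) * B ^ 2 := by
    rw [← norm_mul, h2, add_mul]
    refine (norm_sub_le _ _).trans (add_le_add ?_ ?_)
    · rw [norm_neg]
      refine (hA' (k + 1)).trans ?_
      gcongr
      exact le_self_pow₀ hB two_ne_zero
    · rw [sum_mul]
      refine norm_sum_le_of_le _ fun i hi ↦ ?_
      have hi' : i < k := by simpa using hi
      have := hG i hi'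
      rw [norm_mul, norm_mul, Complex.norm_natCast]
      calc _ ≤ (k.choose i : ℝ) * (G i * B) * (A (k - i) * B) := by
            gcongr
            · exact hG' i hi'
            · exact hA' _
        _ = _ := by ring
  have h4 : ‖iteratedDeriv k (LSeries (twistedLambda χ)) s‖ * (c * B⁻¹) ≤
      (A (k + 1) + ∑ i ∈ range k, (k.choose i : ℝ) * G i * A (k - i)) * B ^ 2 :=
    le_trans (by gcongr) h3
  rw [div_mul_eq_mul_div, le_div_iff₀ hc]
  calc ‖iteratedDeriv k (LSeries (twistedLambda χ)) s‖ * c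
      = ‖iteratedDeriv k (LSeries (twistedLambda χ)) s‖ * (c * B⁻¹) * B := by field_simp
    _ ≤ ((A (k + 1) + ∑ i ∈ range k, (k.choose i : ℝ) * G i * A (k - i)) * B ^ 2) * B := by gcongr
    _ = _ := by ring

lemma iterate_logMul (f : ℕ → ℂ) (k n : ℕ) :
    LSeries.logMul^[k] f n = ((Real.log n ^ k : ℝ) : ℂ) * f n := by
  induction k with
  | zero => simp
  | succ k ih =>
    rw [Function.iterate_succ_apply', LSeries.logMul, ih, ← natCast_log]
    push_cast
    ring

theorem norm_LSeries_log_pow_twist_le {ε : ℝ} (hε : 0 < ε) (hε1 : ε < 1) (k : ℕ) :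
    ∃ C : ℝ, 0 < C ∧ ∀ (q : ℕ) [NeZero q] (χ : DirichletCharacter ℂ q), χ.IsPrimitive → χ ≠ 1 →
      ∀ s : ℂ, 1 < s.re → s.re ≤ 2 →
        LSeriesSummable (fun n ↦ ((Real.log n ^ k : ℝ) : ℂ) * (χ n * Λ n)) s ∧
        ‖LSeries (fun n ↦ ((Real.log n ^ k : ℝ) : ℂ) * (χ n * Λ n)) s‖ ≤
          C * (q * (2 + |s.im|)) ^ ε := by
  obtain ⟨C, hC, h⟩ := norm_iteratedDeriv_logDeriv_le hε hε1 k
  refine ⟨C, hC, fun q _ χ hprim hχ s hs1 hs2 ↦ ?_⟩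
  have habs := abscissaOfAbsConv_twist_vonMangoldt_lt χ hs1
  have hfun : LSeries.logMul^[k] (twistedLambda χ) =
      fun n : ℕ ↦ ((Real.log n ^ k : ℝ) : ℂ) * (χ n * Λ n) := by
    ext n
    rw [iterate_logMul]
    rfl
  rw [← hfun]
  refine ⟨LSeriesSummable_of_abscissaOfAbsConv_lt_re ?_, ?_⟩
  · rwa [LSeries.absicssaOfAbsConv_logPowMul]
  · have := h q χ hprim hχ s hs1 hs2
    rwa [LSeries_iteratedDeriv k habs, norm_mul, norm_pow, norm_neg, norm_one, one_pow,
      one_mul] at this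

end LogDerivative

section SmoothedSum

open Complex MeasureTheory Set Filter Topology

noncomputable def tent (u : ℝ) : ℂ :=
  indicator (Ioc 0 1) (fun _ ↦ 1) u - indicator (Ioc 0 1) (fun t : ℝ ↦ (t : ℂ) ^ (1 : ℂ)) u

lemma tent_of_pos {u : ℝ} (hu : 0 < u) : tent u = ((max (1 - u) 0 : ℝ) : ℂ) := by
  rw [tent]
  rcases le_or_gt u 1 with h | h
  · rw [indicator_of_mem (mem_Ioc.mpr ⟨hu, h⟩), indicator_of_mem (mem_Ioc.mpr ⟨hu, h⟩), cpow_one,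
      max_eq_left (by linarith)]
    push_cast
    rfl
  · rw [indicator_of_notMem (fun h' ↦ h.not_ge h'.2), indicator_of_notMem (fun h' ↦ h.not_ge h'.2),
      max_eq_right (by linarith)]
    simp

lemma hasMellin_tent {s : ℂ} (hs : 0 < s.re) : HasMellin tent s (1 / (s * (s + 1))) := by
  have h1 := hasMellin_one_Ioc hs
  have h2 := hasMellin_cpow_Ioc 1 (s := s) (by rw [one_re]; linarith)
  have h3 := hasMellin_sub h1.1 h2.1
  rw [h1.2, h2.2] at h3
  refine ⟨h3.1, h3.2.trans ?_⟩
  have e1 : s ≠ 0 := by rintro rfl; simp at hs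
  have e2 : s + 1 ≠ 0 := by
    intro h
    have := congrArg Complex.re h
    simp at this
    linarith
  field_simp
  ring

lemma one_add_sq_le_norm_mul {σ : ℝ} (hσ : 1 ≤ σ) (y : ℝ) :
    1 + y ^ 2 ≤ ‖((σ : ℂ) + y * I) * (σ + y * I + 1)‖ := by
  have key (a : ℝ) (ha : 1 ≤ a) : √(1 + y ^ 2) ≤ ‖(a : ℂ) + y * I‖ := by
    rw [Complex.norm_add_mul_I]
    apply Real.sqrt_le_sqrt
    nlinarith
  rw [norm_mul, ← Real.mul_self_sqrt (by positivity : 0 ≤ 1 + y ^ 2)]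
  have h2 := key (σ + 1) (by linarith)
  rw [show ((σ + 1 : ℝ) : ℂ) + y * I = σ + y * I + 1 by push_cast; ring] at h2
  exact mul_le_mul (key σ hσ) h2 (by positivity) (by positivity)

lemma norm_one_div_mul_le {σ : ℝ} (hσ : 1 ≤ σ) (y : ℝ) :
    ‖1 / (((σ : ℂ) + y * I) * (σ + y * I + 1))‖ ≤ (1 + y ^ 2)⁻¹ := by
  rw [norm_div, norm_one, one_div]
  exact inv_anti₀ (by positivity) (one_add_sq_le_norm_mul hσ y)

lemma continuous_one_div_mul {σ : ℝ} (hσ : 1 ≤ σ) :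
    Continuous fun y : ℝ ↦ 1 / (((σ : ℂ) + y * I) * (σ + y * I + 1)) := by
  refine Continuous.div continuous_const (by fun_prop) fun y h ↦ ?_
  have := one_add_sq_le_norm_mul hσ y
  rw [h, norm_zero] at this
  nlinarith [sq_nonneg y]

lemma integrable_one_div_mul {σ : ℝ} (hσ : 1 ≤ σ) :
    Integrable fun y : ℝ ↦ 1 / (((σ : ℂ) + y * I) * (σ + y * I + 1)) :=
  integrable_inv_one_add_sq.mono' (continuous_one_div_mul hσ).aestronglyMeasurable
    (.of_forall (norm_one_div_mul_le hσ))

lemma tent_eq_integral {σ u : ℝ} (hσ : 1 ≤ σ) (hu : 0 < u) :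
    ((max (1 - u) 0 : ℝ) : ℂ) = (1 / (2 * π) : ℝ) * ∫ y : ℝ, (u : ℂ) ^ (-((σ : ℂ) + y * I)) *
      (1 / (((σ : ℂ) + y * I) * (σ + y * I + 1))) := by
  have hre (y : ℝ) : 0 < ((σ : ℂ) + y * I).re := by simp; linarith
  have hM (y : ℝ) : mellin tent (σ + y * I) = 1 / (((σ : ℂ) + y * I) * (σ + y * I + 1)) :=
    (hasMellin_tent (hre y)).2
  have hcont : ContinuousAt tent u := by
    have h1 : ContinuousAt (fun u : ℝ ↦ ((max (1 - u) 0 : ℝ) : ℂ)) u := by fun_prop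
    refine h1.congr ?_
    filter_upwards [lt_mem_nhds hu] with v hv
    exact (tent_of_pos hv).symm
  have := mellinInv_mellin_eq σ tent hu (hasMellin_tent (by simpa using by linarith)).1
    (by simpa only [VerticalIntegrable, hM] using integrable_one_div_mul hσ) hcont
  rw [tent_of_pos hu] at this
  rw [← this, mellinInv]
  simp only [hM, smul_eq_mul, Complex.real_smul]

lemma norm_sum_mul_max_le {a : ℕ → ℂ} (ha : a 0 = 0) {σ x K : ℝ} (hσ : 1 ≤ σ) (hx : 0 < x)
    (hsum : LSeriesSummable a σ)
    (hK : ∀ y : ℝ, ‖LSeries a (σ + y * I)‖ ≤ K * (1 + y ^ 2) ^ (1 / 4 : ℝ)) :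
    ‖∑ n ∈ Finset.range (⌊x⌋₊ + 1), a n * ((max (1 - n / x) 0 : ℝ) : ℂ)‖ ≤
      1 / (2 * π) * (∫ y : ℝ, (1 + y ^ 2) ^ (-(3 / 4) : ℝ)) * K * x ^ σ := by
  set M : ℝ → ℂ := fun y ↦ 1 / (((σ : ℂ) + y * I) * (σ + y * I + 1)) with hM
  set F : ℕ → ℝ → ℂ := fun n y ↦ LSeries.term a (σ + y * I) n * ((x : ℂ) ^ ((σ : ℂ) + y * I) * M y)
    with hF
  have hx' : (x : ℂ) ≠ 0 := by exact_mod_cast hx.ne'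
  have hxn (y : ℝ) : ‖(x : ℂ) ^ ((σ : ℂ) + y * I)‖ = x ^ σ := by
    rw [norm_cpow_eq_rpow_re_of_pos hx]; simp
  have hterm (n : ℕ) (y : ℝ) : ‖LSeries.term a (σ + y * I) n‖ = ‖LSeries.term a σ n‖ := by
    rw [LSeries.norm_term_eq, LSeries.norm_term_eq]; simp
  have hcx : Continuous fun y : ℝ ↦ (x : ℂ) ^ ((σ : ℂ) + y * I) :=
    (by fun_prop : Continuous fun y : ℝ ↦ (σ : ℂ) + y * I).const_cpow (.inl hx')
  have hcterm (n : ℕ) : Continuous fun y : ℝ ↦ LSeries.term a (σ + y * I) n := by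
    rcases eq_or_ne n 0 with rfl | hn
    · simpa using continuous_const
    · simp only [LSeries.term_of_ne_zero hn]
      refine continuous_const.div ?_ fun y ↦ by simp [hn]
      exact (by fun_prop : Continuous fun y : ℝ ↦ (σ : ℂ) + y * I).const_cpow
        (.inl (by exact_mod_cast hn))
  have hFn (n : ℕ) (y : ℝ) : ‖F n y‖ = ‖LSeries.term a σ n‖ * x ^ σ * ‖M y‖ := by
    rw [hF, norm_mul, norm_mul, hterm, hxn, mul_assoc]
  have hMi := integrable_one_div_mul hσ
  have hFint (n : ℕ) : Integrable (F n) := by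
    refine (hMi.norm.const_mul (‖LSeries.term a σ n‖ * x ^ σ)).mono' ?_
      (.of_forall fun y ↦ (hFn n y).le)
    exact ((hcterm n).mul (hcx.mul (continuous_one_div_mul hσ))).aestronglyMeasurable
  have hFsum : Summable fun n ↦ ∫ y, ‖F n y‖ := by
    simp only [hFn, integral_const_mul, mul_assoc]
    exact hsum.norm.mul_right _
  have hmain := hasSum_integral_of_summable_integral_norm hFint hFsum
  have hval (n : ℕ) : ((1 / (2 * π) : ℝ) : ℂ) * ∫ y, F n y =
      a n * ((max (1 - n / x) 0 : ℝ) : ℂ) := by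
    rcases Nat.eq_zero_or_pos n with rfl | hn
    · simp [hF, ha]
    have hn0 : (0 : ℝ) < n := by exact_mod_cast hn
    rw [tent_eq_integral hσ (div_pos hn0 hx), mul_left_comm, ← integral_const_mul (a n)]
    congr 1
    refine integral_congr_ae (.of_forall fun y ↦ ?_)
    simp only [hF, hM]
    rw [LSeries.term_of_ne_zero hn.ne', ofReal_div, cpow_neg,
      div_cpow_ofReal_nonneg hn0.le hx.le, ofReal_natCast]
    have : (n : ℂ) ^ ((σ : ℂ) + y * I) ≠ 0 := by simp [hn.ne']
    field_simp
  have hzero (n : ℕ) (hn : n ∉ Finset.range (⌊x⌋₊ + 1)) :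
      a n * ((max (1 - n / x) 0 : ℝ) : ℂ) = 0 := by
    have : x < n := Nat.lt_of_floor_lt (by simpa using hn)
    rw [max_eq_right, ofReal_zero, mul_zero]
    rw [sub_nonpos, one_le_div hx]
    exact this.le
  have h1 := hmain.mul_left ((1 / (2 * π) : ℝ) : ℂ)
  simp only [hval] at h1
  rw [(hasSum_sum_of_ne_finset_zero hzero).unique h1, norm_mul,
    Complex.norm_real, Real.norm_of_nonneg (by positivity), mul_assoc, mul_assoc]
  gcongr
  have hJ : Integrable fun y : ℝ ↦ (1 + y ^ 2) ^ (-(3 / 4) : ℝ) := by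
    have := integrable_rpow_neg_one_add_norm_sq (E := ℝ) (μ := volume) (r := 3 / 2)
      (by simp; norm_num)
    simpa [show (-(3 / 2) / 2 : ℝ) = -(3 / 4) by norm_num] using this
  rw [mul_comm (∫ y : ℝ, (1 + y ^ 2) ^ (-(3 / 4) : ℝ)), ← integral_const_mul]
  refine norm_integral_le_of_norm_le (hJ.const_mul _) (.of_forall fun y ↦ ?_)
  have h2 : ∑' n, F n y = LSeries a (σ + y * I) * ((x : ℂ) ^ ((σ : ℂ) + y * I) * M y) := by
    rw [hF, tsum_mul_right]; rfl
  have hpos : 0 < 1 + y ^ 2 := by positivity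
  rw [h2, norm_mul, norm_mul, hxn]
  calc _ ≤ K * (1 + y ^ 2) ^ (1 / 4 : ℝ) * (x ^ σ * (1 + y ^ 2)⁻¹) := by
        have := (norm_nonneg _).trans (hK y)
        gcongr
        · exact hK y
        · exact norm_one_div_mul_le hσ y
    _ = K * x ^ σ * ((1 + y ^ 2) ^ (1 / 4 : ℝ) * (1 + y ^ 2) ^ (-1 : ℝ)) := by
        rw [Real.rpow_neg_one]; ring
    _ = _ := by
        rw [← Real.rpow_add hpos]
        norm_num

end SmoothedSum

section Desmoothing

open Complex DirichletCharacter Finset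
open scoped ArithmeticFunction.vonMangoldt

lemma norm_sum_le_of_smoothed {a : ℕ → ℂ} {x h V T₁ T₂ : ℝ} (hx : 0 < x) (hh : 0 < h)
    (hV : ∀ n : ℕ, (n : ℝ) ≤ x + h → ‖a n‖ ≤ V)
    (h1 : ‖∑ n ∈ range (⌊x⌋₊ + 1), a n * ((max (1 - n / x) 0 : ℝ) : ℂ)‖ ≤ T₁)
    (h2 : ‖∑ n ∈ range (⌊x + h⌋₊ + 1), a n * ((max (1 - n / (x + h)) 0 : ℝ) : ℂ)‖ ≤ T₂) :
    ‖∑ n ∈ range (⌊x⌋₊ + 1), a n‖ ≤ ((x + h) * T₂ + x * T₁) / h + (h + 1) * V := by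
  have hV0 : 0 ≤ V := (norm_nonneg _).trans (hV 0 (by simp; linarith))
  have hle : ⌊x⌋₊ + 1 ≤ ⌊x + h⌋₊ + 1 := by
    gcongr
    linarith
  have hsplit := sum_range_add_sum_Ico (fun n ↦ a n * ((max (1 - n / (x + h)) 0 : ℝ) : ℂ)) hle
  have hmain : (h : ℂ) * ∑ n ∈ range (⌊x⌋₊ + 1), a n =
      ((x + h : ℝ) : ℂ) *
        (∑ n ∈ range (⌊x + h⌋₊ + 1), a n * ((max (1 - n / (x + h)) 0 : ℝ) : ℂ)) -
      x * (∑ n ∈ range (⌊x⌋₊ + 1), a n * ((max (1 - n / x) 0 : ℝ) : ℂ)) -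
      ((x + h : ℝ) : ℂ) *
        ∑ n ∈ Ico (⌊x⌋₊ + 1) (⌊x + h⌋₊ + 1), a n * ((max (1 - n / (x + h)) 0 : ℝ) : ℂ) := by
    rw [← hsplit, mul_add, add_sub_right_comm, add_sub_cancel_right, mul_sum, mul_sum, mul_sum,
      ← sum_sub_distrib]
    refine sum_congr rfl fun n hn ↦ ?_
    have hnx : (n : ℝ) ≤ x := (Nat.le_floor_iff hx.le).mp (by simpa [Nat.lt_succ_iff] using hn)
    rw [max_eq_left, max_eq_left]
    · have e1 : ((x + h : ℝ) : ℂ) ≠ 0 := by exact_mod_cast (by positivity : x + h ≠ 0)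
      have e2 : (x : ℂ) ≠ 0 := by exact_mod_cast hx.ne'
      push_cast at e1 ⊢
      field_simp
      ring
    · rw [sub_nonneg, div_le_one hx]; exact hnx
    · rw [sub_nonneg, div_le_one (by positivity)]; linarith
  have hIco : ‖((x + h : ℝ) : ℂ) * ∑ n ∈ Ico (⌊x⌋₊ + 1) (⌊x + h⌋₊ + 1),
      a n * ((max (1 - n / (x + h)) 0 : ℝ) : ℂ)‖ ≤ (h + 1) * (V * h) := by
    rw [mul_sum]
    have hcard : ((Ico (⌊x⌋₊ + 1) (⌊x + h⌋₊ + 1)).card : ℝ) ≤ h + 1 := by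
      rw [Nat.card_Ico, Nat.cast_sub hle]
      push_cast
      linarith [Nat.floor_le (by positivity : 0 ≤ x + h), Nat.lt_floor_add_one x]
    refine (norm_sum_le_of_le _ (fun n hn ↦ (?_ : _ ≤ V * h))).trans ?_
    · rw [mem_Ico] at hn
      have hn1 : x < n := Nat.lt_of_floor_lt hn.1
      have hn2 : (n : ℝ) ≤ x + h := (Nat.le_floor_iff (by positivity)).mp (by omega)
      rw [mul_left_comm, norm_mul]
      refine mul_le_mul (hV n hn2) ?_ (norm_nonneg _) hV0
      rw [max_eq_left (by rw [sub_nonneg, div_le_one (by positivity)]; exact hn2), ← ofReal_mul,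
        Complex.norm_real, mul_sub, mul_div_cancel₀ _ (by positivity), mul_one,
        Real.norm_of_nonneg (by linarith)]
      linarith
    · rw [sum_const, nsmul_eq_mul]
      gcongr
  have hnorm : h * ‖∑ n ∈ range (⌊x⌋₊ + 1), a n‖ ≤ (x + h) * T₂ + x * T₁ + (h + 1) * (V * h) := by
    have := congrArg norm hmain
    rw [norm_mul, Complex.norm_real, Real.norm_of_nonneg hh.le] at this
    rw [this]
    refine (norm_sub_le _ _).trans (add_le_add ((norm_sub_le _ _).trans (add_le_add ?_ ?_)) hIco)
    · rw [norm_mul, Complex.norm_real, Real.norm_of_nonneg (by positivity)]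
      gcongr
    · rw [norm_mul, Complex.norm_real, Real.norm_of_nonneg hx.le]
      gcongr
  rw [← le_div_iff₀' hh] at hnorm
  refine hnorm.trans (le_of_eq ?_)
  field_simp

lemma one_le_log_of_three_le {x : ℝ} (hx : 3 ≤ x) : 1 ≤ Real.log x := by
  rw [Real.le_log_iff_exp_le (by linarith)]
  linarith [Real.exp_one_lt_d9]

lemma log_pow_le {x : ℝ} (hx : 1 ≤ x) (n : ℕ) : Real.log x ^ n ≤ n.factorial * x := by
  have := Real.pow_div_factorial_le_exp (Real.log x) (Real.log_nonneg hx) n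
  rw [Real.exp_log (by linarith), div_le_iff₀ (by positivity)] at this
  linarith

lemma sqrt_two_add_abs_le (y : ℝ) :
    (2 + |y|) ^ (1 / 2 : ℝ) ≤ 2 * (1 + y ^ 2) ^ (1 / 4 : ℝ) := by
  have h1 : 2 + |y| ≤ 4 * (1 + y ^ 2) ^ (1 / 2 : ℝ) := by
    rw [← Real.sqrt_eq_rpow]
    have h2 : |y| ≤ √(1 + y ^ 2) := Real.abs_le_sqrt (by linarith)
    have h3 : 1 ≤ √(1 + y ^ 2) := Real.one_le_sqrt.mpr (by nlinarith)
    linarith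
  calc (2 + |y|) ^ (1 / 2 : ℝ) ≤ (4 * (1 + y ^ 2) ^ (1 / 2 : ℝ)) ^ (1 / 2 : ℝ) := by gcongr
    _ = 2 * (1 + y ^ 2) ^ (1 / 4 : ℝ) := by
        rw [Real.mul_rpow (by norm_num) (by positivity), ← Real.rpow_mul (by positivity),
          show (4 : ℝ) = 2 ^ (2 : ℝ) by norm_num, ← Real.rpow_mul (by norm_num)]
        norm_num

lemma norm_smoothed_twist_le (k : ℕ) :
    ∃ C : ℝ, 0 < C ∧ ∀ (q : ℕ) [NeZero q] (χ : DirichletCharacter ℂ q), χ.IsPrimitive → χ ≠ 1 →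
      ∀ x : ℝ, 3 ≤ x → ‖∑ n ∈ range (⌊x⌋₊ + 1),
        ((Real.log n ^ k : ℝ) : ℂ) * (χ n * Λ n) * ((max (1 - n / x) 0 : ℝ) : ℂ)‖ ≤
          C * √q * x := by
  obtain ⟨C, hC, h⟩ := norm_LSeries_log_pow_twist_le (ε := 1 / 2) (by norm_num) (by norm_num) k
  set J := ∫ y : ℝ, (1 + y ^ 2) ^ (-(3 / 4) : ℝ) with hJ
  have hJ0 : 0 ≤ J := MeasureTheory.integral_nonneg fun y ↦ by positivity
  refine ⟨1 / (2 * π) * J * (2 * C) * rexp 1 + 1, by positivity, fun q _ χ hprim hχ x hx ↦ ?_⟩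
  have hL := one_le_log_of_three_le hx
  have hL0 : 0 < Real.log x := by linarith
  have hx0 : 0 < x := by linarith
  set σ := 1 + 1 / Real.log x with hσ
  have hσ1 : 1 < σ := by rw [hσ]; linarith [show 0 < 1 / Real.log x by positivity]
  have hσ2 : σ ≤ 2 := by
    rw [hσ]; linarith [(div_le_one hL0).mpr hL]
  have hxσ : x ^ σ = rexp 1 * x := by
    rw [hσ, Real.rpow_add hx0, Real.rpow_one, Real.rpow_def_of_pos hx0,
      mul_one_div_cancel hL0.ne', mul_comm]
  have hre (y : ℝ) : ((σ : ℂ) + y * I).re = σ := by simp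
  have him (y : ℝ) : ((σ : ℂ) + y * I).im = y := by simp
  have := norm_sum_mul_max_le (a := fun n ↦ ((Real.log n ^ k : ℝ) : ℂ) * (χ n * Λ n)) (by simp)
    (σ := σ) (x := x) (K := 2 * C * √q) hσ1.le hx0
    (h q χ hprim hχ σ (by simpa) (by simpa)).1 (fun y ↦ ?_)
  · refine this.trans ?_
    rw [hxσ]
    have : 0 ≤ √(q : ℝ) * x := by positivity
    calc _ = 1 / (2 * π) * J * (2 * C) * rexp 1 * (√q * x) := by ring
      _ ≤ (1 / (2 * π) * J * (2 * C) * rexp 1 + 1) * (√q * x) := by gcongr; linarith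
      _ = _ := by ring
  · refine (h q χ hprim hχ (σ + y * I) (by rwa [hre]) (by rwa [hre])).2.trans ?_
    rw [him, Real.mul_rpow (by positivity) (by positivity), Real.sqrt_eq_rpow]
    calc _ ≤ C * ((q : ℝ) ^ (1 / 2 : ℝ) * (2 * (1 + y ^ 2) ^ (1 / 4 : ℝ))) := by
          gcongr
          exact sqrt_two_add_abs_le y
      _ = _ := by ring

lemma norm_log_pow_twist_le {q : ℕ} (χ : DirichletCharacter ℂ q) (k n : ℕ) :
    ‖((Real.log n ^ k : ℝ) : ℂ) * (χ n * Λ n)‖ ≤ Real.log n ^ k * Λ n := by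
  have hl : 0 ≤ Real.log n := Real.log_natCast_nonneg n
  have hΛ : 0 ≤ Λ n := ArithmeticFunction.vonMangoldt_nonneg
  rw [norm_mul, norm_mul, Complex.norm_real, Complex.norm_real, Real.norm_of_nonneg hΛ,
    Real.norm_of_nonneg (by positivity)]
  gcongr
  exact mul_le_of_le_one_left hΛ (χ.norm_le_one _)

lemma norm_sum_log_pow_twist_le {j k : ℕ} (hjk : k + 1 = 2 * j) :
    ∃ C : ℝ, 0 < C ∧ ∀ (q : ℕ) [NeZero q] (χ : DirichletCharacter ℂ q), χ.IsPrimitive → χ ≠ 1 →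
      ∀ x : ℝ, 3 ≤ x → ‖∑ n ∈ range (⌊x⌋₊ + 1), ((Real.log n ^ k : ℝ) : ℂ) * (χ n * Λ n)‖ ≤
          C * √q * x * Real.log x ^ j := by
  obtain ⟨C, hC, h⟩ := norm_smoothed_twist_le k
  refine ⟨5 * C + 4 ^ j * (1 + (2 * j).factorial), by positivity, fun q _ χ hprim hχ x hx ↦ ?_⟩
  have hL := one_le_log_of_three_le hx
  have hx0 : 0 < x := by linarith
  have hLF := log_pow_le (x := x) (by linarith) (2 * j)
  have hlog2 : Real.log (x + x) ≤ 2 * Real.log x := by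
    rw [two_mul, ← Real.log_mul hx0.ne' hx0.ne']
    apply Real.log_le_log (by linarith)
    nlinarith
  have hq : 1 ≤ √(q : ℝ) := Real.one_le_sqrt.mpr (by exact_mod_cast Nat.pos_of_neZero q)
  set L := Real.log x with hLdef
  have hLj := one_le_pow₀ hL (n := j)
  have hL0 : 0 < L := by linarith
  set H := x / L ^ j with hH
  have hH0 : 0 < H := by positivity
  have hHx : H ≤ x := div_le_self hx0.le hLj
  have hV (n : ℕ) (hn : (n : ℝ) ≤ x + H) :
      ‖((Real.log n ^ k : ℝ) : ℂ) * (χ n * Λ n)‖ ≤ (2 * L) ^ (2 * j) := by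
    refine (norm_log_pow_twist_le χ k n).trans ?_
    have hl : 0 ≤ Real.log n := Real.log_natCast_nonneg n
    calc Real.log n ^ k * Λ n ≤ Real.log n ^ k * Real.log n := by
          gcongr
          exact ArithmeticFunction.vonMangoldt_le_log
      _ = Real.log n ^ (2 * j) := by rw [← pow_succ, hjk]
      _ ≤ (2 * L) ^ (2 * j) := by
          gcongr
          refine le_trans ?_ hlog2
          rcases Nat.eq_zero_or_pos n with rfl | h0
          · simpa using Real.log_nonneg (by linarith)
          · exact Real.log_le_log (by exact_mod_cast h0) (by linarith)
  refine (norm_sum_le_of_smoothed hx0 hH0 hV (h q χ hprim hχ x hx)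
    (h q χ hprim hχ (x + H) (by linarith))).trans ?_
  have e1 : ((x + H) * (C * √q * (x + H)) + x * (C * √q * x)) / H ≤
      5 * C * √q * x * L ^ j := by
    calc _ ≤ ((x + x) * (C * √q * (x + x)) + x * (C * √q * x)) / H := by gcongr
      _ = _ := by rw [hH]; field_simp; ring
  have e2 : (H + 1) * (2 * L) ^ (2 * j) ≤ 4 ^ j * (1 + (2 * j).factorial) * √q * x * L ^ j := by
    have e3 : H * L ^ (2 * j) = x * L ^ j := by
      rw [hH, two_mul, pow_add]; field_simp
    calc (H + 1) * (2 * L) ^ (2 * j) = 4 ^ j * (H * L ^ (2 * j) + L ^ (2 * j)) := by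
          rw [mul_pow, pow_mul 2 2 j]; norm_num; ring
      _ ≤ 4 ^ j * (x * L ^ j + (2 * j).factorial * x * L ^ j) := by
          rw [e3]
          gcongr
          exact hLF.trans (le_mul_of_one_le_right (by positivity) hLj)
      _ = 4 ^ j * (1 + (2 * j).factorial) * 1 * x * L ^ j := by ring
      _ ≤ _ := by gcongr
  calc _ ≤ _ := add_le_add e1 e2
    _ = _ := by ring

end Desmoothing

section PrimeSums

open Complex DirichletCharacter Finset
open scoped ArithmeticFunction.vonMangoldt

lemma norm_sum_Ico_mul_le {w : ℕ → ℝ} {b : ℕ → ℂ} {m M : ℕ} {T : ℝ} (hmM : m ≤ M)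
    (hw0 : ∀ n, m ≤ n → 0 ≤ w n) (hw : ∀ n k, m ≤ n → n ≤ k → w k ≤ w n)
    (hT : ∀ N, m ≤ N → N ≤ M → ‖∑ n ∈ Ico m N, b n‖ ≤ T) :
    ‖∑ n ∈ Ico m M, (w n : ℂ) * b n‖ ≤ w m * T := by
  have key : ∀ N, m ≤ N → N ≤ M →
      ‖∑ n ∈ Ico m N, (w n : ℂ) * b n - w N * ∑ n ∈ Ico m N, b n‖ ≤ (w m - w N) * T := by
    intro N hN
    induction N, hN using Nat.le_induction with
    | base => intro; simp
    | succ N hN ih =>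
      intro hNM
      have hstep : ∑ n ∈ Ico m (N + 1), (w n : ℂ) * b n - w (N + 1) * ∑ n ∈ Ico m (N + 1), b n =
          (∑ n ∈ Ico m N, (w n : ℂ) * b n - w N * ∑ n ∈ Ico m N, b n) +
            ((w N - w (N + 1) : ℝ) : ℂ) * ∑ n ∈ Ico m (N + 1), b n := by
        rw [sum_Ico_succ_top hN, sum_Ico_succ_top hN]
        push_cast
        ring
      rw [hstep]
      refine (norm_add_le _ _).trans ((add_le_add (ih (by omega)) ?_).trans
        (le_of_eq (by ring : (w m - w N) * T + (w N - w (N + 1)) * T = _)))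
      have hd : 0 ≤ w N - w (N + 1) := sub_nonneg.mpr (hw N (N + 1) hN (by omega))
      rw [norm_mul, Complex.norm_real, Real.norm_of_nonneg hd]
      exact mul_le_mul_of_nonneg_left (hT _ (by omega) hNM) hd
  have hlast : ‖(w M : ℂ) * ∑ n ∈ Ico m M, b n‖ ≤ w M * T := by
    rw [norm_mul, Complex.norm_real, Real.norm_of_nonneg (hw0 M hmM)]
    exact mul_le_mul_of_nonneg_left (hT M hmM le_rfl) (hw0 M hmM)
  calc ‖∑ n ∈ Ico m M, (w n : ℂ) * b n‖
      = ‖(∑ n ∈ Ico m M, (w n : ℂ) * b n - w M * ∑ n ∈ Ico m M, b n) +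
          w M * ∑ n ∈ Ico m M, b n‖ := by rw [sub_add_cancel]
    _ ≤ (w m - w M) * T + w M * T := (norm_add_le _ _).trans (add_le_add (key M hmM le_rfl) hlast)
    _ = w m * T := by ring

lemma log_sqrt_pow {x : ℝ} (hx : 0 ≤ x) (n : ℕ) :
    Real.log x ^ n = 2 ^ n * Real.log (√x) ^ n := by
  rw [Real.log_sqrt hx, ← mul_pow]
  congr 1
  ring

lemma log_pow_le_sqrt {x : ℝ} (hx : 1 ≤ x) (n : ℕ) :
    Real.log x ^ n ≤ 2 ^ n * n.factorial * √x := by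
  rw [log_sqrt_pow (by linarith), mul_assoc]
  gcongr
  exact log_pow_le (Real.one_le_sqrt.mpr hx) n

lemma norm_sum_not_prime_le {q : ℕ} [NeZero q] (χ : DirichletCharacter ℂ q) (k : ℕ) {x : ℝ}
    (hx : 1 ≤ x) :
    ‖∑ n ∈ range (⌊x⌋₊ + 1) with ¬n.Prime, ((Real.log n ^ k : ℝ) : ℂ) * (χ n * Λ n)‖ ≤
      2 ^ (k + 2) * (k + 1).factorial * x := by
  have hlog : 0 ≤ Real.log x := Real.log_nonneg hx
  have hpsi := Chebyshev.psi_sub_theta_eq_sum_not_prime x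
  have hset : ∑ n ∈ range (⌊x⌋₊ + 1) with ¬n.Prime, Λ n =
      ∑ n ∈ Ioc 0 ⌊x⌋₊ with ¬n.Prime, Λ n := by
    symm
    refine sum_subset ?_ ?_
    · intro n
      simp only [mem_filter, mem_Ioc, mem_range]
      exact fun hn ↦ ⟨by omega, hn.2⟩
    · intro n hn hn'
      have : n = 0 := by
        simp only [mem_filter, mem_Ioc, mem_range] at hn hn'
        by_contra h
        exact hn' ⟨⟨by omega, by omega⟩, hn.2⟩
      simp [this]
  calc ‖∑ n ∈ range (⌊x⌋₊ + 1) with ¬n.Prime, ((Real.log n ^ k : ℝ) : ℂ) * (χ n * Λ n)‖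
      ≤ ∑ n ∈ range (⌊x⌋₊ + 1) with ¬n.Prime, Real.log x ^ k * Λ n := by
        refine norm_sum_le_of_le _ fun n hn ↦ (norm_log_pow_twist_le χ k n).trans ?_
        have hn0 := ArithmeticFunction.vonMangoldt_nonneg (n := n)
        rcases Nat.eq_zero_or_pos n with rfl | hpos
        · simp
        have hnx : (n : ℝ) ≤ x := (Nat.le_floor_iff (by linarith)).mp (by
          simp only [mem_filter, mem_range] at hn; omega)
        have : 0 ≤ Real.log n := Real.log_natCast_nonneg n
        gcongr
    _ = Real.log x ^ k * (Chebyshev.psi x - Chebyshev.theta x) := by rw [← mul_sum, hset, hpsi]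
    _ ≤ Real.log x ^ k * (2 * √x * Real.log x) := by
        gcongr
        exact Chebyshev.psi_sub_theta_le hx
    _ = 2 * √x * Real.log x ^ (k + 1) := by ring
    _ ≤ 2 * √x * (2 ^ (k + 1) * (k + 1).factorial * √x) := by
        gcongr
        exact log_pow_le_sqrt hx _
    _ = 2 ^ (k + 2) * (k + 1).factorial * (√x * √x) := by ring
    _ = _ := by rw [Real.mul_self_sqrt (by linarith)]

lemma norm_sum_prime_log_pow_le {j k : ℕ} (hjk : k + 1 = 2 * j) :
    ∃ C > 0, ∀ (q : ℕ) [NeZero q] (χ : DirichletCharacter ℂ q), χ.IsPrimitive → χ ≠ 1 →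
      ∀ x : ℝ, 3 ≤ x →
        ‖∑ p ∈ range (⌊x⌋₊ + 1) with p.Prime, ((Real.log p ^ (2 * j) : ℝ) : ℂ) * χ p‖ ≤
          C * √q * x * Real.log x ^ j := by
  obtain ⟨C, hC, h⟩ := norm_sum_log_pow_twist_le hjk
  refine ⟨C + 2 ^ (k + 2) * (k + 1).factorial, by positivity, fun q _ χ hχ hχ1 x hx ↦ ?_⟩
  have hsplit := sum_filter_add_sum_filter_not (range (⌊x⌋₊ + 1)) Nat.Prime
    fun n : ℕ ↦ ((Real.log n ^ k : ℝ) : ℂ) * (χ n * Λ n)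
  have hprime : ∑ p ∈ range (⌊x⌋₊ + 1) with p.Prime, ((Real.log p ^ (2 * j) : ℝ) : ℂ) * χ p =
      ∑ p ∈ range (⌊x⌋₊ + 1) with p.Prime, ((Real.log p ^ k : ℝ) : ℂ) * (χ p * Λ p) := by
    refine sum_congr rfl fun p hp ↦ ?_
    rw [ArithmeticFunction.vonMangoldt_apply_prime (mem_filter.mp hp).2, ← hjk, pow_succ]
    push_cast
    ring
  rw [hprime, eq_sub_of_add_eq hsplit, add_mul, add_mul, add_mul]
  refine (norm_sub_le _ _).trans (add_le_add (h q χ hχ hχ1 x hx)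
    ((norm_sum_not_prime_le χ k (by linarith)).trans ?_))
  have h1 : (1 : ℝ) ≤ √q := Real.one_le_sqrt.mpr (by exact_mod_cast NeZero.one_le)
  have h2 : 1 ≤ Real.log x ^ j := one_le_pow₀ (one_le_log_of_three_le hx)
  have hpos : 0 ≤ 2 ^ (k + 2) * ((k + 1).factorial : ℝ) * x := by positivity
  calc _ ≤ 2 ^ (k + 2) * ((k + 1).factorial : ℝ) * x * (√q * Real.log x ^ j) :=
        le_mul_of_one_le_right hpos (one_le_mul_of_one_le_of_one_le h1 h2)
    _ = _ := by ring

lemma norm_sum_prime_tail_le {j k : ℕ} (hjk : k + 1 = 2 * j) :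
    ∃ C > 0, ∀ (q : ℕ) [NeZero q] (χ : DirichletCharacter ℂ q), χ.IsPrimitive → χ ≠ 1 →
      ∀ x : ℝ, 9 ≤ x → ∀ m : ℕ, √x < m → m ≤ ⌊x⌋₊ + 1 →
        ‖∑ p ∈ Ico m (⌊x⌋₊ + 1) with p.Prime, χ p‖ ≤ C * √q * x / Real.log x ^ j := by
  obtain ⟨C, hC, h⟩ := norm_sum_prime_log_pow_le hjk
  refine ⟨2 ^ (2 * j) * (2 * C), by positivity, fun q _ χ hχ hχ1 x hx m hm hmx ↦ ?_⟩
  have hs3 : 3 ≤ √x := Real.le_sqrt_of_sq_le (by linarith)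
  have hm4 : 3 < m := by exact_mod_cast hs3.trans_lt hm
  have hlogx : 0 < Real.log x := by linarith [one_le_log_of_three_le (by linarith : 3 ≤ x)]
  have hlogs : 0 < Real.log (√x) := by linarith [one_le_log_of_three_le hs3]
  have hlogm : ∀ n : ℕ, m ≤ n → 0 < Real.log n := fun n hn ↦
    Real.log_pos (by exact_mod_cast (by omega : 1 < n))
  set b : ℕ → ℂ := fun n ↦ if n.Prime then ((Real.log n ^ (2 * j) : ℝ) : ℂ) * χ n else 0 with hb
  set w : ℕ → ℝ := fun n ↦ (Real.log n ^ (2 * j))⁻¹ with hw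
  have hpart : ∀ N : ℕ, 3 < N → N ≤ ⌊x⌋₊ + 1 →
      ‖∑ n ∈ range N, b n‖ ≤ C * √q * x * Real.log x ^ j := by
    intro N hN hNx
    obtain ⟨M, rfl⟩ : ∃ M, N = M + 1 := ⟨N - 1, by omega⟩
    have hM : (3 : ℝ) ≤ M := by exact_mod_cast (by omega : 3 ≤ M)
    have hMx : (M : ℝ) ≤ x := (Nat.le_floor_iff (by linarith)).mp (by omega)
    have := h q χ hχ hχ1 M hM
    rw [Nat.floor_natCast, sum_filter] at this
    refine this.trans ?_
    have : 0 ≤ Real.log M := Real.log_natCast_nonneg M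
    gcongr
  have hmain := norm_sum_Ico_mul_le (w := w) (b := b) hmx
    (fun n hn ↦ by have := hlogm n hn; positivity)
    (fun n l hn hnl ↦ by
      have hn0 := hlogm n hn
      have : (0 : ℝ) < n := by exact_mod_cast (by omega : 0 < n)
      simp only [hw]
      gcongr)
    (T := 2 * C * √q * x * Real.log x ^ j) (fun N hmN hN ↦ by
      rw [sum_Ico_eq_sub _ hmN]
      refine (norm_sub_le _ _).trans ((add_le_add (hpart N (by omega) hN)
        (hpart m hm4 hmx)).trans (le_of_eq (by ring))))
  have hsum : ∑ p ∈ Ico m (⌊x⌋₊ + 1) with p.Prime, χ p =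
      ∑ n ∈ Ico m (⌊x⌋₊ + 1), (w n : ℂ) * b n := by
    rw [sum_filter]
    refine sum_congr rfl fun n hn ↦ ?_
    have hn0 := hlogm n (mem_Ico.mp hn).1
    simp only [hb, hw]
    split_ifs with hp
    · rw [← mul_assoc, ← ofReal_mul, inv_mul_cancel₀ (by positivity), ofReal_one, one_mul]
    · rw [mul_zero]
  rw [hsum]
  refine hmain.trans ?_
  have hwm : w m ≤ 2 ^ (2 * j) * (Real.log x ^ (2 * j))⁻¹ := by
    rw [log_sqrt_pow (by linarith : 0 ≤ x), mul_inv, mul_inv_cancel_left₀ (by positivity)]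
    simp only [hw]
    gcongr
  calc w m * (2 * C * √q * x * Real.log x ^ j)
      ≤ 2 ^ (2 * j) * (Real.log x ^ (2 * j))⁻¹ * (2 * C * √q * x * Real.log x ^ j) := by gcongr
    _ = _ := by
      rw [two_mul j, pow_add (Real.log x)]
      field_simp

lemma norm_sum_filter_prime_Ico_le {q : ℕ} (χ : DirichletCharacter ℂ q) {a b : ℕ} (ha : 1 ≤ a) :
    ‖∑ p ∈ Ico a (b + 1) with p.Prime, χ p‖ ≤ b := by
  refine (norm_sum_le_of_le _ fun (n : ℕ) _ ↦ χ.norm_le_one (n : ZMod q)).trans ?_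
  rw [sum_const, nsmul_eq_mul, mul_one, Nat.cast_le]
  refine (card_filter_le _ _).trans ?_
  rw [Nat.card_Ico]
  omega

lemma norm_sum_filter_prime_le {j k : ℕ} (hjk : k + 1 = 2 * j) :
    ∃ C > 0, ∀ (q : ℕ) [NeZero q] (χ : DirichletCharacter ℂ q), χ.IsPrimitive → χ ≠ 1 →
      ∀ x : ℝ, 9 ≤ x → ∀ a : ℕ, 1 ≤ a →
        ‖∑ p ∈ Ico a (⌊x⌋₊ + 1) with p.Prime, χ p‖ ≤ C * √q * x / Real.log x ^ j := by
  obtain ⟨C, hC, h⟩ := norm_sum_prime_tail_le hjk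
  refine ⟨C + 2 ^ j * j.factorial, by positivity, fun q _ χ hχ hχ1 x hx a ha ↦ ?_⟩
  have hlogx : 0 < Real.log x := by linarith [one_le_log_of_three_le (by linarith : 3 ≤ x)]
  have hq : (1 : ℝ) ≤ √q := Real.one_le_sqrt.mpr (by exact_mod_cast NeZero.one_le)
  have hsx : ⌊√x⌋₊ ≤ ⌊x⌋₊ := by
    gcongr
    exact Real.sqrt_le_iff.mpr ⟨by linarith, by nlinarith⟩
  have hsmall : ∀ c : ℕ, 1 ≤ c → ‖∑ p ∈ Ico c (⌊√x⌋₊ + 1) with p.Prime, χ p‖ ≤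
      2 ^ j * j.factorial * √q * x / Real.log x ^ j := by
    intro c hc
    refine (norm_sum_filter_prime_Ico_le χ hc).trans ((Nat.floor_le (by positivity)).trans ?_)
    rw [le_div_iff₀ (by positivity)]
    calc √x * Real.log x ^ j ≤ √x * (2 ^ j * j.factorial * √x) := by
          gcongr
          exact log_pow_le_sqrt (by linarith) j
      _ = 2 ^ j * j.factorial * 1 * (√x * √x) := by ring
      _ = 2 ^ j * j.factorial * 1 * x := by rw [Real.mul_self_sqrt (by linarith)]
      _ ≤ _ := by gcongr
  have hadd : (C + 2 ^ j * j.factorial) * √q * x / Real.log x ^ j =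
      2 ^ j * j.factorial * √q * x / Real.log x ^ j + C * √q * x / Real.log x ^ j := by ring
  rcases le_total a (⌊√x⌋₊ + 1) with hle | hle
  · have hsplit := sum_Ico_consecutive (fun n : ℕ ↦ if n.Prime then χ n else 0) hle
      (by omega : ⌊√x⌋₊ + 1 ≤ ⌊x⌋₊ + 1)
    simp only [← sum_filter] at hsplit
    rw [← hsplit, hadd]
    exact (norm_add_le _ _).trans (add_le_add (hsmall a ha) (h q χ hχ hχ1 x hx _
      (by exact_mod_cast Nat.lt_floor_add_one _) (by omega)))
  rcases le_total a (⌊x⌋₊ + 1) with hle' | hle'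
  · refine (h q χ hχ hχ1 x hx a ((Nat.lt_floor_add_one _).trans_le (by exact_mod_cast hle))
      hle').trans ?_
    rw [hadd]
    exact le_add_of_nonneg_left (by positivity)
  · rw [Ico_eq_empty (by omega), filter_empty, sum_empty, norm_zero]
    positivity

lemma _root_.DirichletCharacter.IsPrimitive.ne_one {q : ℕ} {χ : DirichletCharacter ℂ q}
    (hχ : χ.IsPrimitive) (hq : 2 ≤ q) : χ ≠ 1 := by
  rintro rfl
  have : NeZero q := ⟨by omega⟩
  rw [isPrimitive_def, conductor_one] at hχ
  omega

end PrimeSums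

theorem siegel_walfisz_variant :
    ∀ A : ℝ, 1 < A → ∃ C : ℝ, 0 < C ∧
      ∀ (q : ℕ), 2 ≤ q → ∀ (χ : DirichletCharacter ℂ q), χ.IsPrimitive →
        ∀ X Y : ℝ, 2 ≤ Y → Y ≤ X →
          ‖∑ p ∈ (Finset.Icc ⌈Y⌉₊ ⌊X⌋₊).filter Nat.Prime, χ p‖ ≤
            C * Real.sqrt q * X * (Real.log X) ^ (-A) := by
  intro A hA
  have hj : 1 ≤ ⌈A⌉₊ := Nat.one_le_ceil_iff.mpr (by linarith)
  obtain ⟨C, hC, h⟩ := norm_sum_filter_prime_le (j := ⌈A⌉₊) (k := 2 * ⌈A⌉₊ - 1) (by omega)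
  refine ⟨C + log 9 ^ A, by positivity, fun q hq χ hχ X Y hY hYX ↦ ?_⟩
  have : NeZero q := ⟨by omega⟩
  have hceil : 1 ≤ ⌈Y⌉₊ := Nat.one_le_ceil_iff.mpr (by linarith)
  have hX0 : 0 < X := by linarith
  have hlog : 0 < log X := log_pos (by linarith)
  rw [show Finset.Icc ⌈Y⌉₊ ⌊X⌋₊ = Finset.Ico ⌈Y⌉₊ (⌊X⌋₊ + 1) by ext; simp,
    add_mul, add_mul, add_mul]
  rcases le_total 9 X with hX | hX
  · refine (h q χ hχ (hχ.ne_one hq) X hX ⌈Y⌉₊ hceil).trans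
      (le_trans ?_ (le_add_of_nonneg_right (by positivity)))
    rw [div_eq_mul_inv]
    gcongr
    rw [rpow_neg hlog.le]
    gcongr
    rw [← rpow_natCast]
    exact rpow_le_rpow_of_exponent_le (one_le_log_of_three_le (by linarith)) (Nat.le_ceil A)
  · refine (norm_sum_filter_prime_Ico_le χ hceil).trans ((Nat.floor_le (by linarith)).trans
      (le_trans ?_ (le_add_of_nonneg_left (by positivity))))
    have hsq : (1 : ℝ) ≤ √q := one_le_sqrt.mpr (by exact_mod_cast NeZero.one_le)
    have hpow : 1 ≤ log 9 ^ A * log X ^ (-A) := by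
      rw [rpow_neg hlog.le, ← div_eq_mul_inv, one_le_div (by positivity)]
      gcongr
    calc X ≤ X * ((log 9 ^ A * log X ^ (-A)) * √q) :=
          le_mul_of_one_le_right (by linarith) (one_le_mul_of_one_le_of_one_le hpow hsq)
      _ = _ := by ring
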